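/- There exists a constant C > 0 such that for every real x ≥ 2 and every real y > 0 one has ∑_{(a,b)} τ(b⁴ − a⁴)/(b^{5/3}·(b − a)^{1/3}) ≤ C·((log x)⁴·y^{−2/3} + 1), where the sum is over pairs (a,b) of positive integers with a < b ≤ x and y·min{a, b − a} < b. -/

import Mathlib

open scoped Classical

/-- The divisor function `τ(n)`. -/
def tauFn (n : ℕ) : ℕ := n.divisors.card

namespace QuarticDivisorSum

/-- The divisor bound `τ(n) ≪ n ^ ε`. -/
lemma exists_card_divisors_le_rpow {ε : ℝ} (hε : 0 < ε) :
    ∃ C : ℝ, 1 ≤ C ∧ ∀ n : ℕ, (n.divisors.card : ℝ) ≤ C * (n : ℝ) ^ ε := by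
  have hl : 0 < Real.log 2 := Real.log_pos one_lt_two
  set K : ℝ := 1 + 1 / (ε * Real.log 2) with hK
  have hK1 : 1 ≤ K := by rw [hK]; linarith [show 0 < 1 / (ε * Real.log 2) by positivity]
  set P : ℕ := ⌈(2 : ℝ) ^ (1 / ε)⌉₊
  refine ⟨K ^ P, one_le_pow₀ hK1, fun n ↦ ?_⟩
  rcases eq_or_ne n 0 with rfl | hn
  · simp [Real.zero_rpow hε.ne']
  have small (p k : ℕ) (hp : 2 ≤ p) : (k + 1 : ℝ) ≤ K * ((p : ℝ) ^ k) ^ ε := by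
    have h1 : (2 : ℝ) ^ (ε * k) ≤ ((p : ℝ) ^ k) ^ ε := by
      rw [← Real.rpow_natCast, ← Real.rpow_mul (by positivity), mul_comm ε]
      exact Real.rpow_le_rpow (by norm_num) (by exact_mod_cast hp) (by positivity)
    have h2 : 1 + ε * k * Real.log 2 ≤ (2 : ℝ) ^ (ε * k) := by
      rw [Real.rpow_def_of_pos two_pos, add_comm, mul_comm (Real.log 2)]
      exact Real.add_one_le_exp _
    calc (k + 1 : ℝ) ≤ K * (1 + ε * k * Real.log 2) := by
          have : K * (1 + ε * k * Real.log 2) = 1 + k + 1 / (ε * Real.log 2) +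
              ε * k * Real.log 2 := by rw [hK]; field_simp; ring
          rw [this]
          have : 0 ≤ 1 / (ε * Real.log 2) + ε * k * Real.log 2 := by positivity
          linarith
      _ ≤ _ := by gcongr; exact h2.trans h1
  have large (p k : ℕ) (hp : P ≤ p) : (k + 1 : ℝ) ≤ ((p : ℝ) ^ k) ^ ε := by
    have h1 : (2 : ℝ) ≤ (p : ℝ) ^ ε := by
      have : (2 : ℝ) ^ (1 / ε) ≤ p := (Nat.le_ceil _).trans (by exact_mod_cast hp)
      calc (2 : ℝ) = ((2 : ℝ) ^ (1 / ε)) ^ ε := by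
            rw [← Real.rpow_mul (by norm_num), one_div_mul_cancel hε.ne', Real.rpow_one]
        _ ≤ _ := by gcongr
    have h2 : ((p : ℝ) ^ k) ^ ε = ((p : ℝ) ^ ε) ^ k := by
      rw [← Real.rpow_natCast, ← Real.rpow_mul (by positivity), mul_comm, Real.rpow_mul
        (by positivity), Real.rpow_natCast]
    rw [h2]
    calc (k + 1 : ℝ) ≤ 2 ^ k := by exact_mod_cast Nat.lt_two_pow_self
      _ ≤ _ := by gcongr
  have hprod : ((n : ℝ)) ^ ε = ∏ p ∈ n.primeFactors, ((p : ℝ) ^ n.factorization p) ^ ε := by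
    rw [Real.finsetProd_rpow _ _ (fun _ _ ↦ by positivity)]
    congr 1
    conv_lhs => rw [← Nat.prod_factorization_pow_eq_self hn]
    rw [Finsupp.prod]
    push_cast
    rfl
  rw [Nat.card_divisors hn, hprod]
  push_cast
  calc ∏ p ∈ n.primeFactors, ((n.factorization p : ℝ) + 1)
      ≤ ∏ p ∈ n.primeFactors, ((if p < P then K else 1) *
        ((p : ℝ) ^ n.factorization p) ^ ε) := by
        refine Finset.prod_le_prod (fun _ _ ↦ by positivity) fun p hp ↦ ?_
        split_ifs with h
        · exact small _ _ (Nat.prime_of_mem_primeFactors hp).two_le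
        · rw [one_mul]; exact large _ _ (not_lt.1 h)
    _ = K ^ (n.primeFactors.filter (· < P)).card *
        ∏ p ∈ n.primeFactors, ((p : ℝ) ^ n.factorization p) ^ ε := by
        rw [Finset.prod_mul_distrib, Finset.prod_ite]; simp
    _ ≤ _ := by
        gcongr
        calc _ ≤ (Finset.range P).card := Finset.card_le_card fun p hp ↦ by
              simpa using (Finset.mem_filter.1 hp).2
          _ = P := by simp

/-- Upper bound in Mertens' first theorem. -/
lemma sum_primesBelow_log_div_le (w : ℕ) :
    ∑ p ∈ w.primesBelow, Real.log p / p ≤ Real.log w + Real.log 4 := by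
  rcases Nat.eq_zero_or_pos w with rfl | hw
  · simp only [Nat.primesBelow_zero, Finset.sum_empty, Nat.cast_zero, Real.log_zero, zero_add]
    exact Real.log_nonneg (by norm_num)
  have hw' : (0 : ℝ) < w := by exact_mod_cast hw
  have hlog : ∀ p : ℕ, 0 ≤ Real.log p := fun p ↦ Real.log_natCast_nonneg p
  have h1 : ∑ p ∈ w.primesBelow, Real.log p * ((w / p : ℕ) : ℝ) ≤ w * Real.log w := by
    calc ∑ p ∈ w.primesBelow, Real.log p * ((w / p : ℕ) : ℝ)
        = ∑ p ∈ w.primesBelow, ∑ n ∈ Finset.Ioc 0 w, if p ∣ n then Real.log p else 0 := by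
          refine Finset.sum_congr rfl fun p _ ↦ ?_
          rw [← Finset.sum_filter, Finset.sum_const, nsmul_eq_mul, mul_comm,
            Nat.Ioc_filter_dvd_card_eq_div]
      _ = ∑ n ∈ Finset.Ioc 0 w, ∑ p ∈ w.primesBelow with p ∣ n, Real.log p := by
          rw [Finset.sum_comm]; simp_rw [Finset.sum_filter]
      _ ≤ ∑ n ∈ Finset.Ioc 0 w, Real.log w := by
          refine Finset.sum_le_sum fun n hn ↦ ?_
          rw [Finset.mem_Ioc] at hn
          have : ∑ p ∈ w.primesBelow with p ∣ n, Real.log p ≤ ∑ p ∈ n.primeFactors, Real.log p := by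
            refine Finset.sum_le_sum_of_subset_of_nonneg (fun p hp ↦ ?_) fun _ _ _ ↦ hlog _
            rw [Finset.mem_filter, Nat.mem_primesBelow] at hp
            exact Nat.mem_primeFactors.2 ⟨hp.1.2, hp.2, hn.1.ne'⟩
          refine this.trans ?_
          rw [← Real.log_prod (fun p hp ↦ by
            exact_mod_cast (Nat.prime_of_mem_primeFactors hp).ne_zero), ← Nat.cast_prod]
          have hpos : 0 < ∏ p ∈ n.primeFactors, p :=
            Finset.prod_pos fun p hp ↦ (Nat.prime_of_mem_primeFactors hp).pos
          gcongr
          exact (Nat.le_of_dvd hn.1 (Nat.prod_primeFactors_dvd n)).trans hn.2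
      _ = _ := by simp
  have h2 : ∑ p ∈ w.primesBelow, Real.log p ≤ Real.log 4 * w := by
    refine le_trans ?_ (Chebyshev.theta_le_log4_mul_x hw'.le)
    rw [Chebyshev.theta_eq_sum_primesLE_log]
    refine Finset.sum_le_sum_of_subset_of_nonneg (fun p hp ↦ ?_) fun _ _ _ ↦ hlog _
    rw [Nat.mem_primesBelow] at hp
    exact Nat.mem_primesLE.2 ⟨hp.1.le, hp.2⟩
  have h3 : w * ∑ p ∈ w.primesBelow, Real.log p / p ≤
      ∑ p ∈ w.primesBelow, Real.log p * ((w / p : ℕ) : ℝ) +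
        ∑ p ∈ w.primesBelow, Real.log p := by
    rw [Finset.mul_sum, ← Finset.sum_add_distrib]
    refine Finset.sum_le_sum fun p _ ↦ ?_
    have : (w : ℝ) / p ≤ ((w / p : ℕ) : ℝ) + 1 := by
      rw [← Nat.floor_div_eq_div (K := ℝ)]; exact (Nat.lt_floor_add_one _).le
    calc (w : ℝ) * (Real.log p / p) = Real.log p * (w / p) := by ring
      _ ≤ Real.log p * (((w / p : ℕ) : ℝ) + 1) := by gcongr
      _ = _ := by ring
  refine le_of_mul_le_mul_left (a := (w : ℝ)) ?_ hw'
  linarith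

/-- The nontrivial character modulo `4`, with complex values. -/
noncomputable def chiFour : DirichletCharacter ℂ 4 := ZMod.χ₄.ringHomComp (Int.castRingHom ℂ)

lemma chiFour_apply (n : ZMod 4) : chiFour n = (ZMod.χ₄ n : ℂ) := rfl

lemma chiFour_ne_one : chiFour ≠ 1 := by
  intro h
  have h3 : chiFour 3 = (1 : DirichletCharacter ℂ 4) 3 := by rw [h]
  rw [chiFour_apply, MulChar.one_apply (by decide), show ZMod.χ₄ 3 = -1 by decide] at h3
  norm_num at h3

lemma exists_norm_zeta_cube_mul_LSeries_le : ∃ C : ℝ, 0 < C ∧ ∀ s : ℝ, 1 < s → s ≤ 2 →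
    ‖riemannZeta s ^ 3 * LSeries (fun n ↦ chiFour n) s‖ ≤ C * (s - 1)⁻¹ ^ 3 := by
  have hc1 : Continuous fun s : ℝ ↦ ‖DirichletCharacter.LFunctionTrivChar₁ 1 s ^ 3 *
      DirichletCharacter.LFunction chiFour s‖ := by
    have h1 := (DirichletCharacter.differentiable_LFunctionTrivChar₁ 1).continuous
    have h2 := (DirichletCharacter.differentiable_LFunction chiFour_ne_one).continuous
    fun_prop
  obtain ⟨C, hC⟩ := (isCompact_Icc (a := (1 : ℝ)) (b := 2)).bddAbove_image hc1.continuousOn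
  refine ⟨max C 1, by positivity, fun s hs hs2 ↦ ?_⟩
  have h := hC (Set.mem_image_of_mem _ (Set.mem_Icc.2 ⟨hs.le, hs2⟩))
  have hs1 : (s : ℂ) ≠ 1 := by exact_mod_cast hs.ne'
  rw [DirichletCharacter.LFunctionTrivChar₁, Function.update_of_ne hs1,
    DirichletCharacter.LFunctionTrivChar, DirichletCharacter.LFunction_modOne_eq,
    DirichletCharacter.LFunction_eq_LSeries _ (by simpa using hs)] at h
  have h0 : 0 < s - 1 := by linarith
  rw [inv_pow, ← div_eq_mul_inv, le_div_iff₀ (by positivity)]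
  calc _ = ‖(((s : ℂ) - 1) * riemannZeta s) ^ 3 * LSeries (fun n ↦ chiFour n) s‖ := by
        have : ‖(s : ℂ) - 1‖ = s - 1 := by
          rw [← Complex.ofReal_one, ← Complex.ofReal_sub, Complex.norm_real, Real.norm_eq_abs,
            abs_of_pos h0]
        simp only [norm_mul, norm_pow, this]; ring
    _ ≤ C := h
    _ ≤ _ := le_max_left _ _

lemma one_add_mul_le_eulerFactor {x : ℝ} {c : ℤ} (hx : 0 ≤ x) (hx1 : x < 1)
    (hc : c = 0 ∨ c = 1 ∨ c = -1) :
    1 + (3 + c) * x ≤ (1 - x)⁻¹ ^ 3 * (1 - c * x)⁻¹ := by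
  have h0 : 0 < 1 - x := by linarith
  have hb : ((1 + x) * (1 - x)) ≤ 1 := by nlinarith
  have hb0 : 0 ≤ (1 + x) * (1 - x) := by positivity
  have h3 : ((1 + x) * (1 - x)) ^ 3 ≤ 1 := pow_le_one₀ hb0 hb
  have h4 : ((1 + x) * (1 - x)) ^ 4 ≤ 1 := pow_le_one₀ hb0 hb
  rcases hc with rfl | rfl | rfl
  · have : 1 + 3 * x ≤ (1 + x) ^ 3 := by nlinarith [pow_nonneg hx 2, pow_nonneg hx 3]
    simp only [Int.cast_zero, zero_mul, sub_zero, inv_one, mul_one, add_zero]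
    rw [inv_pow, ← one_div, le_div_iff₀ (by positivity)]
    calc _ ≤ (1 + x) ^ 3 * (1 - x) ^ 3 := by gcongr
      _ ≤ 1 := by rwa [← mul_pow]
  · have : 1 + 4 * x ≤ (1 + x) ^ 4 := by
      nlinarith [pow_nonneg hx 2, pow_nonneg hx 3, pow_nonneg hx 4]
    simp only [Int.cast_one, one_mul]
    rw [← pow_succ, inv_pow, ← one_div, le_div_iff₀ (by positivity)]
    calc _ ≤ (1 + x) ^ 4 * (1 - x) ^ 4 := by gcongr; linarith
      _ ≤ 1 := by rwa [← mul_pow]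
  · have : 1 + 2 * x ≤ (1 + x) ^ 2 := by nlinarith
    rw [inv_pow, ← mul_inv, ← one_div, le_div_iff₀ (by push_cast; nlinarith [pow_pos h0 3])]
    push_cast
    calc _ ≤ (1 + x) ^ 2 * ((1 - x) ^ 3 * (1 - -1 * x)) := by
          have : 0 ≤ 1 - -1 * x := by linarith
          gcongr; linarith
      _ = ((1 + x) * (1 - x)) ^ 3 := by ring
      _ ≤ 1 := h3

lemma norm_one_sub_mul_prime_cpow_inv {p : ℕ} (hp : p.Prime) {s : ℝ} (hs : 1 < s) {c : ℤ}
    (hc : c = 0 ∨ c = 1 ∨ c = -1) :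
    ‖(1 - (c : ℂ) * (p : ℂ) ^ (-(s : ℂ)))⁻¹‖ = (1 - c * (p : ℝ) ^ (-s))⁻¹ := by
  have hx1 : (p : ℝ) ^ (-s) < 1 :=
    Real.rpow_lt_one_of_one_lt_of_neg (by exact_mod_cast hp.one_lt) (by linarith)
  have hx0 : 0 ≤ (p : ℝ) ^ (-s) := by positivity
  have h : (p : ℂ) ^ (-(s : ℂ)) = ((p : ℝ) ^ (-s) : ℝ) := by
    rw [Complex.ofReal_cpow (by positivity)]; push_cast; rfl
  have h2 : 0 ≤ 1 - (c : ℝ) * (p : ℝ) ^ (-s) := by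
    rcases hc with rfl | rfl | rfl <;> push_cast <;> linarith
  rw [h, norm_inv, ← Complex.ofReal_intCast, ← Complex.ofReal_mul, ← Complex.ofReal_one,
    ← Complex.ofReal_sub, Complex.norm_real, Real.norm_eq_abs, abs_of_nonneg h2]

lemma chi_four_cases (n : ZMod 4) : ZMod.χ₄ n = 0 ∨ ZMod.χ₄ n = 1 ∨ ZMod.χ₄ n = -1 := by
  revert n; decide

lemma prod_primesBelow_le_norm_zeta_cube_mul_LSeries (w : ℕ) {s : ℝ} (hs : 1 < s) :
    ∏ p ∈ w.primesBelow, (1 + (3 + ZMod.χ₄ p) * (p : ℝ) ^ (-s)) ≤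
      ‖riemannZeta s ^ 3 * LSeries (fun n ↦ chiFour n) s‖ := by
  have hs' : 1 < (s : ℂ).re := by simpa using hs
  have ht := (((riemannZeta_eulerProduct hs').pow 3).mul
    (DirichletCharacter.LSeries_eulerProduct chiFour hs')).norm
  set g : ℕ → ℝ := fun p ↦ (1 - (p : ℝ) ^ (-s))⁻¹ ^ 3 * (1 - ZMod.χ₄ p * (p : ℝ) ^ (-s))⁻¹
  have hg (p : ℕ) (hp : p.Prime) : 1 + (3 + ZMod.χ₄ p) * (p : ℝ) ^ (-s) ≤ g p :=
    one_add_mul_le_eulerFactor (by positivity)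
      (Real.rpow_lt_one_of_one_lt_of_neg (by exact_mod_cast hp.one_lt) (by linarith))
      (chi_four_cases p)
  have h0 (p : ℕ) : 0 ≤ (3 + ZMod.χ₄ p : ℝ) * (p : ℝ) ^ (-s) := by
    have : (0 : ℝ) ≤ 3 + ZMod.χ₄ p := by
      rcases chi_four_cases p with h | h | h <;> rw [h] <;> norm_num
    positivity
  have heq (n : ℕ) : ‖(∏ p ∈ n.primesBelow, (1 - (p : ℂ) ^ (-(s : ℂ)))⁻¹) ^ 3 *
      ∏ p ∈ n.primesBelow, (1 - chiFour p * (p : ℂ) ^ (-(s : ℂ)))⁻¹‖ =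
      ∏ p ∈ n.primesBelow, g p := by
    rw [norm_mul, norm_pow, norm_prod, norm_prod, ← Finset.prod_pow, ← Finset.prod_mul_distrib]
    refine Finset.prod_congr rfl fun p hp ↦ ?_
    have hp' := (Nat.mem_primesBelow.1 hp).2
    have h1 := norm_one_sub_mul_prime_cpow_inv hp' hs (c := 1) (by simp)
    have h2 := norm_one_sub_mul_prime_cpow_inv hp' hs (chi_four_cases p)
    rw [chiFour_apply, h2]
    simp only [Int.cast_one, one_mul] at h1
    rw [h1]
  simp only [heq] at ht
  have hmono : Monotone fun n : ℕ ↦ ∏ p ∈ n.primesBelow, g p := by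
    refine monotone_nat_of_le_succ fun n ↦ ?_
    rw [Nat.primesBelow_succ]
    split_ifs with hn
    · rw [Finset.prod_insert (by simp [Nat.mem_primesBelow])]
      refine le_mul_of_one_le_left (Finset.prod_nonneg fun p hp ↦ ?_) ?_
      · linarith [hg p (Nat.mem_primesBelow.1 hp).2, h0 p]
      · linarith [hg n hn, h0 n]
    · exact le_rfl
  refine le_trans (Finset.prod_le_prod (fun p _ ↦ by linarith [h0 p]) fun p hp ↦
    hg p (Nat.mem_primesBelow.1 hp).2) (hmono.ge_of_tendsto ht w)

/-- The number of fourth roots of unity modulo `m`. -/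
noncomputable def quarticRootCount (m : ℕ) : ℕ := Nat.card {u : (ZMod m)ˣ // u ^ 4 = 1}

lemma quarticRootCount_one : quarticRootCount 1 = 1 := by
  rw [quarticRootCount, Nat.card_eq_one_iff_unique]
  exact ⟨⟨fun a b ↦ Subsingleton.elim _ _⟩, ⟨⟨1, one_pow 4⟩⟩⟩

lemma quarticRootCount_mul {m n : ℕ} (h : m.Coprime n) :
    quarticRootCount (m * n) = quarticRootCount m * quarticRootCount n := by
  let e : (ZMod (m * n))ˣ ≃* (ZMod m)ˣ × (ZMod n)ˣ :=
    (Units.mapEquiv (ZMod.chineseRemainder h).toMulEquiv).trans MulEquiv.prodUnits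
  rw [quarticRootCount, quarticRootCount, quarticRootCount, ← Nat.card_prod]
  refine Nat.card_congr ((e.toEquiv.subtypeEquiv (q := fun x ↦ x.1 ^ 4 = 1 ∧ x.2 ^ 4 = 1)
    fun u ↦ ?_).trans (Equiv.subtypeProdEquivProd (p := fun x : (ZMod m)ˣ ↦ x ^ 4 = 1)
      (q := fun x : (ZMod n)ˣ ↦ x ^ 4 = 1)))
  rw [← (map_eq_one_iff e e.injective), map_pow, Prod.ext_iff]
  rfl

lemma card_pow_eq_one_le {G : Type*} [Group G] [Finite G] [IsCyclic G] {n : ℕ} (hn : 0 < n) :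
    Nat.card {u : G // u ^ n = 1} ≤ n := by
  have := Fintype.ofFinite G
  rw [Nat.card_eq_fintype_card, Fintype.card_subtype]
  exact IsCyclic.card_pow_eq_one_le hn

lemma quarticRootCount_odd_prime_pow_le {p : ℕ} (hp : p.Prime) (hp2 : p ≠ 2) (k : ℕ) :
    quarticRootCount (p ^ k) ≤ 4 := by
  have : NeZero (p ^ k) := ⟨pow_ne_zero _ hp.ne_zero⟩
  have := ZMod.isCyclic_units_of_prime_pow p hp hp2 k
  exact card_pow_eq_one_le (by norm_num)

lemma two_pow_dvd_sub_or_add_of_dvd {n : ℕ} {t : ℤ} (h : (2 : ℤ) ^ (n + 3) ∣ t ^ 4 - 1) :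
    (2 : ℤ) ^ (n + 1) ∣ t - 1 ∨ (2 : ℤ) ^ (n + 1) ∣ t + 1 := by
  have hodd : Odd t := by
    by_contra hev
    obtain ⟨j, rfl⟩ := Int.not_odd_iff_even.1 hev
    have h2 : (2 : ℤ) ∣ (j + j) ^ 4 - 1 := (dvd_pow_self 2 (by omega)).trans h
    have h3 : (2 : ℤ) ∣ (j + j) ^ 4 := Dvd.intro (8 * j ^ 4) (by ring)
    have := (Int.dvd_iff_dvd_of_dvd_sub h2).1 h3
    omega
  obtain ⟨j, rfl⟩ := hodd
  have h1 : (2 : ℤ) ^ n ∣ (2 * (j ^ 2 + j) + 1) * (j * (j + 1)) := by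
    rw [show (2 * j + 1) ^ 4 - 1 = 2 ^ 3 * ((2 * (j ^ 2 + j) + 1) * (j * (j + 1))) by ring,
      pow_add, mul_comm] at h
    exact Int.dvd_of_mul_dvd_mul_left (by norm_num) h
  have h2 : (2 : ℤ) ^ n ∣ j * (j + 1) :=
    Int.prime_two.pow_dvd_of_dvd_mul_left n (by omega) h1
  have key {x : ℤ} (hx : (2 : ℤ) ^ n ∣ x) : (2 : ℤ) ^ (n + 1) ∣ 2 * x := by
    rw [pow_succ, mul_comm]; exact mul_dvd_mul_left 2 hx
  by_cases hj : (2 : ℤ) ∣ j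
  · left
    have := key (Int.prime_two.pow_dvd_of_dvd_mul_right n (by omega) h2)
    simpa using this
  · right
    have := key (Int.prime_two.pow_dvd_of_dvd_mul_left n hj h2)
    rwa [show 2 * (j + 1) = 2 * j + 1 + 1 by ring] at this

lemma quarticRootCount_two_pow_le (k : ℕ) : quarticRootCount (2 ^ k) ≤ 8 := by
  have : NeZero (2 ^ k) := ⟨by positivity⟩
  rcases lt_or_ge k 3 with hk | hk
  · calc quarticRootCount (2 ^ k) ≤ Nat.card (ZMod (2 ^ k)) :=
          Nat.card_le_card_of_injective (fun u ↦ ((u.1 : (ZMod (2 ^ k))ˣ) : ZMod (2 ^ k)))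
            fun a b h ↦ Subtype.ext (Units.ext h)
      _ = 2 ^ k := Nat.card_zmod _
      _ ≤ 2 ^ 3 := Nat.pow_le_pow_right (by norm_num) hk.le
  obtain ⟨n, rfl⟩ := Nat.exists_eq_add_of_le' hk
  have hlt (u : (ZMod (2 ^ (n + 3)))ˣ) : (u : ZMod (2 ^ (n + 3))).val / 2 ^ (n + 1) < 4 := by
    rw [Nat.div_lt_iff_lt_mul (by positivity)]
    refine (ZMod.val_lt _).trans_eq ?_
    ring
  let f : {u : (ZMod (2 ^ (n + 3)))ˣ // u ^ 4 = 1} → Prop × Fin 4 := fun u ↦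
    ((2 : ℤ) ^ (n + 1) ∣ ((u.1 : ZMod (2 ^ (n + 3))).val : ℤ) - 1,
      ⟨(u.1 : ZMod (2 ^ (n + 3))).val / 2 ^ (n + 1), hlt u.1⟩)
  have hf : Function.Injective f := by
    intro u v huv
    have hdvd (u : {u : (ZMod (2 ^ (n + 3)))ˣ // u ^ 4 = 1}) :
        (2 : ℤ) ^ (n + 3) ∣ ((u.1 : ZMod (2 ^ (n + 3))).val : ℤ) ^ 4 - 1 := by
      have h1 : ((u.1 : ZMod (2 ^ (n + 3)))) ^ 4 = 1 := by
        rw [← Units.val_pow_eq_pow_val, u.2, Units.val_one]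
      have := (ZMod.intCast_zmod_eq_zero_iff_dvd
        (((u.1 : ZMod (2 ^ (n + 3))).val : ℤ) ^ 4 - 1) (2 ^ (n + 3))).1 (by
          push_cast; rw [ZMod.natCast_zmod_val, h1, sub_self])
      exact_mod_cast this
    simp only [f, Prod.mk.injEq, Fin.mk.injEq, eq_iff_iff] at huv
    have hmod : (2 : ℤ) ^ (n + 1) ∣
        ((u.1 : ZMod (2 ^ (n + 3))).val : ℤ) - ((v.1 : ZMod (2 ^ (n + 3))).val : ℤ) := by
      by_cases hu : (2 : ℤ) ^ (n + 1) ∣ ((u.1 : ZMod (2 ^ (n + 3))).val : ℤ) - 1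
      · have := dvd_sub hu (huv.1.1 hu)
        rwa [sub_sub_sub_cancel_right] at this
      · have := dvd_sub ((two_pow_dvd_sub_or_add_of_dvd (hdvd u)).resolve_left hu)
          ((two_pow_dvd_sub_or_add_of_dvd (hdvd v)).resolve_left fun h ↦ hu (huv.1.2 h))
        rwa [add_sub_add_right_eq_sub] at this
    have hmod' : (u.1 : ZMod (2 ^ (n + 3))).val % 2 ^ (n + 1) =
        (v.1 : ZMod (2 ^ (n + 3))).val % 2 ^ (n + 1) :=
      (Nat.modEq_iff_dvd.2 (by exact_mod_cast hmod) : _ ≡ _ [MOD 2 ^ (n + 1)]).symm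
    have hval : (u.1 : ZMod (2 ^ (n + 3))).val = (v.1 : ZMod (2 ^ (n + 3))).val := by
      rw [← Nat.div_add_mod (u.1 : ZMod (2 ^ (n + 3))).val (2 ^ (n + 1)), huv.2, hmod',
        Nat.div_add_mod]
    exact Subtype.ext (Units.ext (ZMod.val_injective _ hval))
  calc quarticRootCount (2 ^ (n + 3)) ≤ Nat.card (Prop × Fin 4) :=
        Nat.card_le_card_of_injective f hf
    _ = 8 := by simp

lemma quarticRootCount_prime_pow_le {p : ℕ} (hp : p.Prime) (k : ℕ) :
    quarticRootCount (p ^ k) ≤ 8 := by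
  rcases eq_or_ne p 2 with rfl | h2
  · exact quarticRootCount_two_pow_le k
  · exact (quarticRootCount_odd_prime_pow_le hp h2 k).trans (by norm_num)

lemma quarticRootCount_prime_le {p : ℕ} (hp : p.Prime) :
    (quarticRootCount p : ℤ) ≤ 3 + ZMod.χ₄ p := by
  rcases hp.eq_two_or_odd with rfl | hodd
  · have : quarticRootCount 2 ≤ 1 := by
      have : Subsingleton (ZMod 2)ˣ := ⟨by decide⟩
      exact Finite.card_le_one_iff_subsingleton.2 ⟨fun a b ↦ Subsingleton.elim _ _⟩
    have h : (0 : ℤ) ≤ 3 + ZMod.χ₄ ((2 : ℕ) : ZMod 4) - 1 := by decide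
    omega
  · have h4 : quarticRootCount p ≤ 4 := by
      simpa using quarticRootCount_odd_prime_pow_le hp (by rintro rfl; omega) 1
    rcases Nat.odd_mod_four_iff.1 hodd with h | h
    · rw [ZMod.χ₄_nat_one_mod_four h]; omega
    · rw [ZMod.χ₄_nat_three_mod_four h]
      have : Fact p.Prime := ⟨hp⟩
      have hle : quarticRootCount p ≤ Nat.card {u : (ZMod p)ˣ // u ^ 2 = 1} := by
        refine Nat.card_le_card_of_injective (fun u ↦ ⟨u.1, ?_⟩) fun a b hab ↦
          Subtype.ext (Subtype.mk_eq_mk.1 hab)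
        have h1 : (u.1 : (ZMod p)ˣ) ^ (p - 1) = 1 := ZMod.units_pow_card_sub_one_eq_one p u.1
        have h2 : (p - 1).gcd 4 = 2 := by
          obtain ⟨q, hq⟩ : ∃ q, p - 1 = 2 + 4 * q := ⟨p / 4, by omega⟩
          rw [hq]; simp
        rw [← h2]
        exact pow_gcd_eq_one.2 ⟨h1, u.2⟩
      have := hle.trans (card_pow_eq_one_le (G := (ZMod p)ˣ) (n := 2) (by norm_num))
      omega

/-- The arithmetic function `n ↦ τ(n) n ^ α`. -/
noncomputable def twistedTau (α : ℝ) : ArithmeticFunction ℝ :=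
  ⟨fun n ↦ (n.divisors.card : ℝ) * (n : ℝ) ^ α, by simp⟩

/-- The Möbius transform of `n ↦ τ(n) n ^ α`. -/
noncomputable def tauKernel (α : ℝ) : ArithmeticFunction ℝ :=
  (ArithmeticFunction.moebius : ArithmeticFunction ℝ) * twistedTau α

lemma twistedTau_apply (α : ℝ) (n : ℕ) :
    twistedTau α n = (n.divisors.card : ℝ) * (n : ℝ) ^ α := rfl

lemma twistedTau_isMultiplicative (α : ℝ) : (twistedTau α).IsMultiplicative := by
  refine ⟨by simp [twistedTau_apply], fun {m n} h ↦ ?_⟩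
  simp only [twistedTau_apply, h.card_divisors_mul]
  push_cast
  rw [Real.mul_rpow (by positivity) (by positivity)]
  ring

lemma tauKernel_isMultiplicative (α : ℝ) : (tauKernel α).IsMultiplicative :=
  (ArithmeticFunction.isMultiplicative_moebius.intCast).mul (twistedTau_isMultiplicative α)

lemma sum_divisors_tauKernel (α : ℝ) (n : ℕ) :
    ∑ m ∈ n.divisors, tauKernel α m = (n.divisors.card : ℝ) * (n : ℝ) ^ α := by
  rw [← ArithmeticFunction.coe_mul_zeta_apply, tauKernel, mul_comm _ (twistedTau α), mul_assoc,
    ArithmeticFunction.coe_moebius_mul_coe_zeta, mul_one, twistedTau_apply]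

lemma tauKernel_prime_pow_succ (α : ℝ) {p : ℕ} (hp : p.Prime) (k : ℕ) :
    tauKernel α (p ^ (k + 1)) =
      (k + 2) * ((p : ℝ) ^ α) ^ (k + 1) - (k + 1) * ((p : ℝ) ^ α) ^ k := by
  have h (j : ℕ) : ∑ i ∈ Finset.range (j + 1), tauKernel α (p ^ i) =
      (j + 1) * ((p : ℝ) ^ α) ^ j := by
    rw [← Nat.sum_divisors_prime_pow hp, sum_divisors_tauKernel, Nat.divisors_prime_pow hp]
    have : ((p : ℝ) ^ j) ^ α = ((p : ℝ) ^ α) ^ j := by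
      rw [← Real.rpow_natCast, ← Real.rpow_mul (by positivity), mul_comm, Real.rpow_mul
        (by positivity), Real.rpow_natCast]
    simp [this]
  have h1 := h (k + 1)
  rw [Finset.sum_range_succ, h k] at h1
  push_cast at h1
  linarith

lemma tauKernel_nonneg {α : ℝ} (hα : 0 ≤ α) (n : ℕ) : 0 ≤ tauKernel α n := by
  rcases eq_or_ne n 0 with rfl | hn
  · simp
  rw [(tauKernel_isMultiplicative α).multiplicative_factorization _ hn]
  refine Finset.prod_nonneg fun p hp ↦ ?_
  have hp' := Nat.prime_of_mem_primeFactors (Nat.support_factorization n ▸ hp)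
  rcases n.factorization p with _ | k
  · simp [(tauKernel_isMultiplicative α).map_one]
  · beta_reduce
    rw [tauKernel_prime_pow_succ α hp']
    have h1 : 1 ≤ (p : ℝ) ^ α := Real.one_le_rpow (by exact_mod_cast hp'.one_le) hα
    have h2 : 0 < ((p : ℝ) ^ α) ^ k := by positivity
    rw [pow_succ]
    have : (k + 1 : ℝ) * ((p : ℝ) ^ α) ^ k ≤ (k + 2) * (((p : ℝ) ^ α) ^ k * (p : ℝ) ^ α) := by
      have := le_mul_of_one_le_right h2.le h1
      gcongr
      norm_num
    linarith

lemma tauKernel_prime_pow_le {α : ℝ} {p : ℕ} (hp : p.Prime) (k : ℕ) :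
    tauKernel α (p ^ k) ≤ (k + 1) * ((p : ℝ) ^ α) ^ k := by
  rcases k with _ | k
  · simp [(tauKernel_isMultiplicative α).map_one]
  · rw [tauKernel_prime_pow_succ α hp]
    push_cast
    have : 0 ≤ (k + 1 : ℝ) * ((p : ℝ) ^ α) ^ k := by positivity
    linarith

/-- The density weight attached to a modulus `m`. -/
noncomputable def localWeight (α : ℝ) (m : ℕ) : ℝ := tauKernel α m * (quarticRootCount m / m)

lemma localWeight_nonneg {α : ℝ} (hα : 0 ≤ α) (n : ℕ) : 0 ≤ localWeight α n :=
  mul_nonneg (tauKernel_nonneg hα n) (by positivity)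

lemma localWeight_one (α : ℝ) : localWeight α 1 = 1 := by
  simp [localWeight, (tauKernel_isMultiplicative α).map_one, quarticRootCount_one]

lemma localWeight_mul (α : ℝ) {m n : ℕ} (h : m.Coprime n) :
    localWeight α (m * n) = localWeight α m * localWeight α n := by
  simp only [localWeight, (tauKernel_isMultiplicative α).map_mul_of_coprime h,
    quarticRootCount_mul h]
  push_cast
  rw [mul_div_mul_comm]
  ring

/-- The constant bounding the contribution of proper prime powers to a local factor. -/
noncomputable def primePowerConst : ℝ := ∑' k : ℕ, 8 * (k + 3) * ((2 : ℝ) ^ (-(3 : ℝ) / 4)) ^ k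

lemma summable_primePowerConst :
    Summable fun k : ℕ ↦ 8 * ((k : ℝ) + 3) * ((2 : ℝ) ^ (-(3 : ℝ) / 4)) ^ k := by
  have hr : ‖(2 : ℝ) ^ (-(3 : ℝ) / 4)‖ < 1 := by
    rw [Real.norm_of_nonneg (by positivity)]
    exact Real.rpow_lt_one_of_one_lt_of_neg (by norm_num) (by norm_num)
  have h1 := summable_pow_mul_geometric_of_norm_lt_one 1 hr
  have h2 := summable_geometric_of_norm_lt_one hr
  refine ((h1.mul_left 8).add (h2.mul_left 24)).congr fun k ↦ ?_
  ring

lemma localWeight_prime_pow_add_two_le {α : ℝ} (hα4 : α ≤ 1 / 4) {p : ℕ}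
    (hp : p.Prime) (k : ℕ) : localWeight α (p ^ (k + 2)) ≤
      (p : ℝ) ^ (-(3 : ℝ) / 2) * (8 * ((k : ℝ) + 3) * ((2 : ℝ) ^ (-(3 : ℝ) / 4)) ^ k) := by
  have hp0 : (0 : ℝ) < p := by exact_mod_cast hp.pos
  have hp1 : (1 : ℝ) ≤ p := by exact_mod_cast hp.one_le
  have h1 := tauKernel_prime_pow_le (α := α) hp (k + 2)
  have h2 : (quarticRootCount (p ^ (k + 2)) : ℝ) ≤ 8 := by
    exact_mod_cast quarticRootCount_prime_pow_le hp _
  have h3 : (p : ℝ) ^ α / p ≤ (p : ℝ) ^ (-(3 : ℝ) / 4) := by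
    rw [div_eq_mul_inv, ← Real.rpow_neg_one (p : ℝ), ← Real.rpow_add hp0]
    exact Real.rpow_le_rpow_of_exponent_le hp1 (by linarith)
  have h4 : (p : ℝ) ^ (-(3 : ℝ) / 4) ≤ (2 : ℝ) ^ (-(3 : ℝ) / 4) :=
    Real.rpow_le_rpow_of_nonpos two_pos (by exact_mod_cast hp.two_le) (by norm_num)
  have h5 : (p : ℝ) ^ (-(3 : ℝ) / 2) = ((p : ℝ) ^ (-(3 : ℝ) / 4)) ^ 2 := by
    rw [← Real.rpow_natCast, ← Real.rpow_mul hp0.le]; norm_num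
  calc localWeight α (p ^ (k + 2))
      ≤ ((k + 2 : ℕ) + 1) * ((p : ℝ) ^ α) ^ (k + 2) * (8 / ((p ^ (k + 2) : ℕ) : ℝ)) := by
        rw [localWeight]; gcongr
    _ = 8 * ((k : ℝ) + 3) * ((p : ℝ) ^ α / p) ^ (k + 2) := by
        push_cast; rw [div_pow]; ring
    _ ≤ 8 * ((k : ℝ) + 3) * ((p : ℝ) ^ (-(3 : ℝ) / 4)) ^ (k + 2) := by gcongr
    _ = 8 * ((k : ℝ) + 3) * (((p : ℝ) ^ (-(3 : ℝ) / 4)) ^ k * ((p : ℝ) ^ (-(3 : ℝ) / 4)) ^ 2) := by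
        rw [pow_add]
    _ ≤ 8 * ((k : ℝ) + 3) * (((2 : ℝ) ^ (-(3 : ℝ) / 4)) ^ k * ((p : ℝ) ^ (-(3 : ℝ) / 4)) ^ 2) := by
        gcongr
    _ = _ := by rw [h5]; ring

lemma summable_localWeight_prime_pow {α : ℝ} (hα : 0 ≤ α) (hα4 : α ≤ 1 / 4) {p : ℕ}
    (hp : p.Prime) : Summable fun k ↦ localWeight α (p ^ k) := by
  rw [← summable_nat_add_iff 2]
  exact Summable.of_nonneg_of_le (fun k ↦ localWeight_nonneg hα _)
    (fun k ↦ localWeight_prime_pow_add_two_le hα4 hp k) (summable_primePowerConst.mul_left _)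

lemma tsum_localWeight_prime_pow_le {α : ℝ} (hα : 0 ≤ α) (hα4 : α ≤ 1 / 4) {p : ℕ}
    (hp : p.Prime) : ∑' k, localWeight α (p ^ k) ≤
      1 + (3 + ZMod.χ₄ p) / p + (8 * ((p : ℝ) ^ α - 1) / p +
        primePowerConst * (p : ℝ) ^ (-(3 : ℝ) / 2)) := by
  have hp0 : (0 : ℝ) < p := by exact_mod_cast hp.pos
  have hs := summable_localWeight_prime_pow hα hα4 hp
  rw [← hs.sum_add_tsum_nat_add 2]
  have h1 : ∑' k, localWeight α (p ^ (k + 2)) ≤ primePowerConst * (p : ℝ) ^ (-(3 : ℝ) / 2) := by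
    rw [primePowerConst, mul_comm, ← tsum_mul_left]
    exact ((summable_nat_add_iff 2).2 hs).tsum_le_tsum
      (fun k ↦ localWeight_prime_pow_add_two_le hα4 hp k) (summable_primePowerConst.mul_left _)
  have h2 : localWeight α p ≤ (3 + ZMod.χ₄ p) / p + 8 * ((p : ℝ) ^ α - 1) / p := by
    have hk := tauKernel_prime_pow_succ α hp 0
    have hR : (quarticRootCount p : ℝ) ≤ 3 + ZMod.χ₄ p := by
      exact_mod_cast quarticRootCount_prime_le hp
    have hR4 : (3 + ZMod.χ₄ p : ℝ) ≤ 4 := by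
      rcases chi_four_cases p with h | h | h <;> rw [h] <;> norm_num
    have hα1 : 1 ≤ (p : ℝ) ^ α := Real.one_le_rpow (by exact_mod_cast hp.one_le) hα
    simp only [zero_add, pow_one, pow_zero, mul_one, CharP.cast_eq_zero] at hk
    rw [localWeight, hk, ← mul_div_assoc, ← add_div]
    gcongr
    nlinarith
  simp only [Finset.sum_range_succ, Finset.sum_range_zero, pow_zero, pow_one, localWeight_one,
    zero_add]
  linarith

lemma inv_le_rpow_neg_add {p : ℕ} (hp : p.Prime) (s : ℝ) :
    (p : ℝ)⁻¹ ≤ (p : ℝ) ^ (-s) + (s - 1) * (Real.log p / p) := by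
  have hp0 : (0 : ℝ) < p := by exact_mod_cast hp.pos
  have h1 : (p : ℝ) ^ (-s) = (p : ℝ)⁻¹ * Real.exp (Real.log p * (-(s - 1))) := by
    rw [← Real.rpow_def_of_pos hp0, ← Real.rpow_neg_one, ← Real.rpow_add hp0]
    congr 1; ring
  have h2 := Real.add_one_le_exp (Real.log p * (-(s - 1)))
  have h3 : (p : ℝ)⁻¹ * (Real.log p * (-(s - 1)) + 1) ≤
      (p : ℝ)⁻¹ * Real.exp (Real.log p * (-(s - 1))) := by gcongr
  rw [h1]
  calc (p : ℝ)⁻¹ = (p : ℝ)⁻¹ * (Real.log p * (-(s - 1)) + 1) + (s - 1) * (Real.log p / p) := by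
        rw [div_eq_mul_inv]; ring
    _ ≤ _ := by gcongr

lemma rpow_sub_one_le {x α : ℝ} (hx : 0 < x) :
    x ^ α - 1 ≤ α * Real.log x * x ^ α := by
  have h := Real.add_one_le_exp (-(α * Real.log x))
  have h1 : x ^ α * Real.exp (-(α * Real.log x)) = 1 := by
    rw [Real.rpow_def_of_pos hx, ← Real.exp_add]; simp [mul_comm]
  have h2 : x ^ α * (-(α * Real.log x) + 1) ≤ x ^ α * Real.exp (-(α * Real.log x)) := by gcongr
  rw [h1] at h2
  linarith

lemma one_le_log_of_three_le {w : ℕ} (hw : 3 ≤ w) : 1 ≤ Real.log w := by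
  rw [Real.le_log_iff_exp_le (by positivity)]
  have : (3 : ℝ) ≤ w := by exact_mod_cast hw
  linarith [Real.exp_one_lt_d9]

lemma primePowerConst_nonneg : 0 ≤ primePowerConst := tsum_nonneg fun _ ↦ by positivity

lemma exists_prod_tsum_localWeight_le (B : ℝ) : ∃ C : ℝ, 0 < C ∧ ∀ w : ℕ, 3 ≤ w → ∀ α : ℝ, 0 ≤ α →
    α ≤ 1 / 4 → α * Real.log w ≤ B →
    ∏ p ∈ w.primesBelow, ∑' k, localWeight α (p ^ k) ≤ C * Real.log w ^ 3 := by
  obtain ⟨C, hC, hCζ⟩ := exists_norm_zeta_cube_mul_LSeries_le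
  set S : ℝ := ∑' n : ℕ, (n : ℝ) ^ (-(3 : ℝ) / 2)
  have hS : Summable fun n : ℕ ↦ (n : ℝ) ^ (-(3 : ℝ) / 2) :=
    Real.summable_nat_rpow.2 (by norm_num)
  set M : ℝ := 12 + 24 * B * Real.exp B + primePowerConst * S
  refine ⟨C * Real.exp M, by positivity, fun w hw α hα hα4 hαw ↦ ?_⟩
  set l := Real.log w with hl
  have hl1 : 1 ≤ l := one_le_log_of_three_le hw
  have hl0 : 0 < l := by linarith
  set s := 1 + l⁻¹ with hsdef
  have hs1 : 1 < s := by rw [hsdef]; linarith [inv_pos.2 hl0]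
  have hs2 : s ≤ 2 := by rw [hsdef]; linarith [inv_le_one_of_one_le₀ hl1]
  have hss : s - 1 = l⁻¹ := by rw [hsdef]; ring
  let E : ℕ → ℝ := fun p ↦ (4 * l⁻¹ + 8 * α * Real.exp B) * (Real.log p / p) +
    primePowerConst * (p : ℝ) ^ (-(3 : ℝ) / 2)
  have hE0 (p : ℕ) : 0 ≤ E p := by
    have := Real.log_natCast_nonneg p
    have := primePowerConst_nonneg
    positivity
  have hχ (p : ℕ) : (0 : ℝ) ≤ 3 + ZMod.χ₄ p ∧ (3 + ZMod.χ₄ p : ℝ) ≤ 4 := by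
    rcases chi_four_cases p with h | h | h <;> rw [h] <;> norm_num
  have hlocal (p : ℕ) (hp : p ∈ w.primesBelow) : ∑' k, localWeight α (p ^ k) ≤
      (1 + (3 + ZMod.χ₄ p) * (p : ℝ) ^ (-s)) * Real.exp (E p) := by
    obtain ⟨hpw, hp⟩ := Nat.mem_primesBelow.1 hp
    have hp0 : (0 : ℝ) < p := by exact_mod_cast hp.pos
    have hlp := Real.log_natCast_nonneg p
    obtain ⟨hc0, hc4⟩ := hχ p
    refine (tsum_localWeight_prime_pow_le hα hα4 hp).trans ?_
    have h1 : (3 + ZMod.χ₄ p : ℝ) / p ≤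
        (3 + ZMod.χ₄ p) * (p : ℝ) ^ (-s) + 4 * l⁻¹ * (Real.log p / p) := by
      have := inv_le_rpow_neg_add hp s
      rw [hss] at this
      calc (3 + ZMod.χ₄ p : ℝ) / p = (3 + ZMod.χ₄ p) * (p : ℝ)⁻¹ := div_eq_mul_inv _ _
        _ ≤ (3 + ZMod.χ₄ p) * ((p : ℝ) ^ (-s) + l⁻¹ * (Real.log p / p)) := by gcongr
        _ = (3 + ZMod.χ₄ p) * (p : ℝ) ^ (-s) + (3 + ZMod.χ₄ p) * (l⁻¹ * (Real.log p / p)) := by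
          ring
        _ ≤ (3 + ZMod.χ₄ p) * (p : ℝ) ^ (-s) + 4 * (l⁻¹ * (Real.log p / p)) := by gcongr
        _ = _ := by ring
    have h2 : 8 * ((p : ℝ) ^ α - 1) / p ≤ 8 * α * Real.exp B * (Real.log p / p) := by
      have hpB : (p : ℝ) ^ α ≤ Real.exp B := by
        rw [Real.rpow_def_of_pos hp0]
        gcongr
        calc Real.log p * α ≤ l * α := by
              gcongr
              exact Real.log_le_log hp0 (by exact_mod_cast hpw.le)
          _ ≤ B := by rwa [mul_comm]
      calc 8 * ((p : ℝ) ^ α - 1) / p ≤ 8 * (α * Real.log p * Real.exp B) / p := by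
            gcongr
            exact (rpow_sub_one_le hp0).trans (by gcongr)
        _ = _ := by ring
    have hx : 0 ≤ (3 + ZMod.χ₄ p : ℝ) * (p : ℝ) ^ (-s) := by positivity
    calc _ ≤ 1 + (3 + ZMod.χ₄ p) * (p : ℝ) ^ (-s) + E p := by simp only [E]; linarith
      _ ≤ (1 + (3 + ZMod.χ₄ p) * (p : ℝ) ^ (-s)) * (1 + E p) := by
        have := mul_nonneg hx (hE0 p)
        linarith
      _ ≤ _ := by gcongr; linarith [Real.add_one_le_exp (E p)]
  have hsumE : ∑ p ∈ w.primesBelow, E p ≤ M := by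
    rw [Finset.sum_add_distrib, ← Finset.mul_sum, ← Finset.mul_sum]
    have h1 := sum_primesBelow_log_div_le w
    have h2 : ∑ p ∈ w.primesBelow, (p : ℝ) ^ (-(3 : ℝ) / 2) ≤ S :=
      hS.sum_le_tsum _ fun _ _ ↦ by positivity
    have h3 : Real.log 4 ≤ 2 * l := by
      rw [show (4 : ℝ) = 2 ^ 2 by norm_num, Real.log_pow]
      push_cast
      linarith [Real.log_two_lt_d9]
    have h4 : (4 * l⁻¹ + 8 * α * Real.exp B) * ∑ p ∈ w.primesBelow, Real.log p / p ≤
        12 + 24 * B * Real.exp B := by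
      calc _ ≤ (4 * l⁻¹ + 8 * α * Real.exp B) * (3 * l) := by gcongr; linarith
        _ = 12 * (l⁻¹ * l) + 24 * (α * l) * Real.exp B := by ring
        _ ≤ 12 + 24 * B * Real.exp B := by
          rw [inv_mul_cancel₀ hl0.ne', mul_one]; gcongr
    have h5 := mul_le_mul_of_nonneg_left h2 primePowerConst_nonneg
    simp only [M]
    linarith
  calc ∏ p ∈ w.primesBelow, ∑' k, localWeight α (p ^ k)
      ≤ ∏ p ∈ w.primesBelow, (1 + (3 + ZMod.χ₄ p) * (p : ℝ) ^ (-s)) * Real.exp (E p) :=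
        Finset.prod_le_prod (fun p _ ↦ tsum_nonneg fun k ↦ localWeight_nonneg hα _) hlocal
    _ = (∏ p ∈ w.primesBelow, (1 + (3 + ZMod.χ₄ p) * (p : ℝ) ^ (-s))) *
        Real.exp (∑ p ∈ w.primesBelow, E p) := by
        rw [Finset.prod_mul_distrib, Real.exp_sum]
    _ ≤ (C * (s - 1)⁻¹ ^ 3) * Real.exp M := by
        have := (prod_primesBelow_le_norm_zeta_cube_mul_LSeries w hs1).trans (hCζ s hs1 hs2)
        gcongr
    _ = C * Real.exp M * l ^ 3 := by rw [hss, inv_inv]; ring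

/-- The sum of the local weights over smooth moduli grows at most like the cube of the logarithm. -/
lemma exists_sum_localWeight_le (B : ℝ) : ∃ C : ℝ, 0 < C ∧ ∀ w : ℕ, 3 ≤ w → ∀ α : ℝ, 0 ≤ α →
    α ≤ 1 / 4 → α * Real.log w ≤ B → ∀ T : Finset ℕ, (∀ m ∈ T, m ∈ w.smoothNumbers) →
    ∑ m ∈ T, localWeight α m ≤ C * Real.log w ^ 3 := by
  obtain ⟨C, hC, h⟩ := exists_prod_tsum_localWeight_le B
  refine ⟨C, hC, fun w hw α hα hα4 hαw T hT ↦ le_trans ?_ (h w hw α hα hα4 hαw)⟩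
  have hs := (EulerProduct.summable_and_hasSum_smoothNumbers_prod_primesBelow_tsum
    (f := localWeight α) (localWeight_one α) (fun h ↦ localWeight_mul α h)
    (fun hp ↦ (summable_localWeight_prime_pow hα hα4 hp).norm) w).2
  rw [← Finset.sum_subtype_of_mem (localWeight α) hT]
  exact sum_le_hasSum _ (fun m _ ↦ localWeight_nonneg hα _) hs

lemma card_divisors_mul_le (m n : ℕ) :
    (m * n).divisors.card ≤ m.divisors.card * n.divisors.card := by
  rw [Nat.divisors_mul]; exact Finset.card_mul_le

lemma card_divisors_list_prod_le {l : List ℕ} (hl : ∀ p ∈ l, p.Prime) :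
    l.prod.divisors.card ≤ 2 ^ l.length := by
  induction l with
  | nil => simp
  | cons p l ih =>
    have hp := hl p (by simp)
    rw [List.prod_cons, List.length_cons, pow_succ']
    refine (card_divisors_mul_le _ _).trans (Nat.mul_le_mul ?_ (ih fun q hq ↦ hl q (by simp [hq])))
    rw [hp.divisors]
    exact Finset.card_le_two

/-- The largest divisor of `n` all of whose prime factors are below `w`. -/
def smoothPart (w n : ℕ) : ℕ := (n.primeFactorsList.filter (· < w)).prod

lemma smoothPart_mem (w n : ℕ) : smoothPart w n ∈ w.smoothNumbers :=
  Nat.prod_mem_smoothNumbers n w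

lemma list_prod_filter_mul_prod_filter_not (p : ℕ → Bool) (l : List ℕ) :
    (l.filter p).prod * (l.filter fun x ↦ !p x).prod = l.prod := by
  induction l with
  | nil => simp
  | cons a l ih =>
    rw [List.prod_cons, ← ih]
    cases h : p a <;> simp [h] <;> ring

lemma smoothPart_mul (w : ℕ) {n : ℕ} (hn : n ≠ 0) :
    smoothPart w n * (n.primeFactorsList.filter (fun p ↦ !decide (p < w))).prod = n := by
  conv_rhs => rw [← Nat.prod_primeFactorsList hn]
  exact list_prod_filter_mul_prod_filter_not _ _

lemma smoothPart_dvd (w : ℕ) {n : ℕ} (hn : n ≠ 0) : smoothPart w n ∣ n :=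
  Dvd.intro _ (smoothPart_mul w hn)

lemma smoothPart_dvd_smoothPart {w' w : ℕ} (h : w' ≤ w) (n : ℕ) :
    smoothPart w' n ∣ smoothPart w n :=
  (List.monotone_filter_right _ fun p hp ↦ by
    simp only [decide_eq_true_eq] at hp ⊢; omega).prod_dvd_prod

lemma pow_length_le_list_prod_pow {l : List ℕ} {X u : ℕ} (h : ∀ p ∈ l, X ≤ p ^ u) :
    X ^ l.length ≤ l.prod ^ u := by
  induction l with
  | nil => simp
  | cons p l ih =>
    rw [List.prod_cons, List.length_cons, pow_succ', mul_pow]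
    exact Nat.mul_le_mul (h p (by simp)) (ih fun q hq ↦ h q (by simp [hq]))

lemma card_divisors_le_smoothPart {n X w u : ℕ} (hn : n ≠ 0) (hX : 1 < X) (hnX : n ≤ X ^ 32)
    (hw : ∀ p, w ≤ p → X ≤ p ^ u) :
    n.divisors.card ≤ 2 ^ (32 * u) * (smoothPart w n).divisors.card := by
  set l := n.primeFactorsList.filter (fun p ↦ !decide (p < w)) with hl
  have hlp : ∀ p ∈ l, p.Prime := fun p hp ↦
    Nat.prime_of_mem_primeFactorsList (List.mem_of_mem_filter hp)
  have hlen : l.length ≤ 32 * u := by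
    have h1 : X ^ l.length ≤ l.prod ^ u := pow_length_le_list_prod_pow fun p hp ↦ by
      have := (List.mem_filter.1 hp).2
      exact hw p (by simpa using this)
    have h2 : l.prod ≤ n := Nat.le_of_dvd (Nat.pos_of_ne_zero hn)
      (Dvd.intro_left _ (smoothPart_mul w hn))
    have h3 : X ^ l.length ≤ X ^ (32 * u) := by
      rw [pow_mul]
      exact h1.trans (Nat.pow_le_pow_left (h2.trans hnX) u)
    exact (Nat.pow_le_pow_iff_right hX).1 h3
  calc n.divisors.card = (smoothPart w n * l.prod).divisors.card := by rw [smoothPart_mul w hn]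
    _ ≤ (smoothPart w n).divisors.card * l.prod.divisors.card := card_divisors_mul_le _ _
    _ ≤ (smoothPart w n).divisors.card * 2 ^ (32 * u) := by
      gcongr
      exact (card_divisors_list_prod_le hlp).trans (Nat.pow_le_pow_right (by norm_num) hlen)
    _ = _ := mul_comm _ _

lemma exists_dvd_dvd_lt_le_sq {s S X : ℕ} (hsS : s ∣ S) (hs : s ≤ X) (hX : X < S)
    (hp : ∀ p, p.Prime → p ∣ S → p ≤ X) : ∃ t, s ∣ t ∧ t ∣ S ∧ X < t ∧ t ≤ X ^ 2 := by
  have hex : ∃ t, s ∣ t ∧ t ∣ S ∧ X < t := ⟨S, hsS, dvd_rfl, hX⟩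
  obtain ⟨h1, h2, h3⟩ := Nat.find_spec hex
  set t := Nat.find hex with ht
  refine ⟨t, h1, h2, h3, ?_⟩
  obtain ⟨c, hc⟩ := h1
  have hc1 : c ≠ 1 := by rintro rfl; omega
  obtain ⟨p, hpp, d, rfl⟩ := Nat.exists_prime_and_dvd hc1
  have htp : t = p * (s * d) := by rw [hc]; ring
  have hdt : s * d ∣ t := Dvd.intro_left p htp.symm
  have hlt : s * d < t := by
    have : 0 < t := by omega
    have h0 : 0 < s * d := Nat.pos_of_dvd_of_pos hdt this
    rw [htp]
    exact lt_mul_of_one_lt_left h0 hpp.one_lt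
  have hmin := Nat.find_min hex hlt
  have hle : s * d ≤ X := by
    by_contra hcon
    exact hmin ⟨Dvd.intro _ rfl, hdt.trans h2, not_le.1 hcon⟩
  rw [htp, sq]
  exact Nat.mul_le_mul (hp p hpp ((Dvd.intro _ htp.symm).trans h2)) hle

/-- The truncated smooth divisor sum of the kernel `tauKernel α`. -/
noncomputable def kernelSum (α : ℝ) (w Y n : ℕ) : ℝ :=
  ∑ m ∈ n.divisors with m ≤ Y ∧ m ∈ w.smoothNumbers, tauKernel α m

lemma kernelSum_nonneg {α : ℝ} (hα : 0 ≤ α) (w Y n : ℕ) : 0 ≤ kernelSum α w Y n :=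
  Finset.sum_nonneg fun _ _ ↦ tauKernel_nonneg hα _

lemma card_divisors_mul_rpow_le_kernelSum {α : ℝ} (hα : 0 ≤ α) {w Y n t : ℕ} (hn : n ≠ 0)
    (htn : t ∣ n) (htY : t ≤ Y) (htw : t ∈ w.smoothNumbers) :
    (t.divisors.card : ℝ) * (t : ℝ) ^ α ≤ kernelSum α w Y n := by
  rw [← sum_divisors_tauKernel]
  refine Finset.sum_le_sum_of_subset_of_nonneg (fun m hm ↦ ?_) fun _ _ _ ↦ tauKernel_nonneg hα _
  have hmt := Nat.dvd_of_mem_divisors hm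
  have ht0 : t ≠ 0 := Nat.ne_zero_of_mem_smoothNumbers htw
  rw [Finset.mem_filter, Nat.mem_divisors]
  exact ⟨⟨hmt.trans htn, hn⟩, (Nat.le_of_dvd (Nat.pos_of_ne_zero ht0) hmt).trans htY,
    Nat.mem_smoothNumbers_of_dvd htw hmt⟩

lemma card_divisors_mul_rpow_le_kernelSum_of_lt {α : ℝ} (hα : 0 ≤ α) {w n s X : ℕ} (hn : n ≠ 0)
    (hX0 : 0 < X) (hwX : ∀ p, p < w → p ≤ X) (hs : s ∣ smoothPart w n) (hsX : s ≤ X)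
    (hX : X < smoothPart w n) :
    (s.divisors.card : ℝ) * (X : ℝ) ^ α ≤ kernelSum α w (X ^ 2) n := by
  have hmem := smoothPart_mem w n
  obtain ⟨t, hst, htS, hXt, htX⟩ := exists_dvd_dvd_lt_le_sq hs hsX hX fun p hp hpS ↦
    hwX p ((Nat.mem_smoothNumbers'.1 hmem) p hp hpS)
  have ht0 : t ≠ 0 := by omega
  refine le_trans ?_ (card_divisors_mul_rpow_le_kernelSum hα hn
    (htS.trans (smoothPart_dvd w hn)) htX (Nat.mem_smoothNumbers_of_dvd hmem htS))
  gcongr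

/-- The smoothness threshold `2 ^ (132 V / u)`. -/
noncomputable def smoothBound (V u : ℕ) : ℕ := ⌊(2 : ℝ) ^ (132 * V / u : ℝ)⌋₊ + 1

lemma lt_smoothBound_iff (V u p : ℕ) :
    p < smoothBound V u ↔ (p : ℝ) ≤ (2 : ℝ) ^ (132 * V / u : ℝ) := by
  rw [smoothBound, Nat.lt_succ_iff, Nat.le_floor_iff (by positivity)]

lemma smoothBound_antitone (V : ℕ) {u u' : ℕ} (hu : 0 < u) (h : u ≤ u') :
    smoothBound V u' ≤ smoothBound V u := by
  rw [smoothBound, smoothBound]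
  gcongr
  norm_num

lemma le_pow_of_smoothBound_le {V u p : ℕ} (hu : 0 < u) (hp : smoothBound V u ≤ p) :
    2 ^ (132 * V) ≤ p ^ u := by
  have h : (2 : ℝ) ^ (132 * V / u : ℝ) < p := by
    rw [← not_le, ← lt_smoothBound_iff]; omega
  have h2 : ((2 : ℝ) ^ (132 * V / u : ℝ)) ^ u ≤ (p : ℝ) ^ u := by gcongr
  rw [← Real.rpow_natCast, ← Real.rpow_mul (by norm_num), div_mul_cancel₀ _ (by positivity)] at h2
  have h3 : ((132 : ℝ) * V) = ((132 * V : ℕ) : ℝ) := by push_cast; rfl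
  rw [h3, Real.rpow_natCast] at h2
  exact_mod_cast h2

lemma le_pow_of_lt_smoothBound {V u p : ℕ} (hu : 0 < u) (hp : p < smoothBound V u) :
    p ≤ 2 ^ (132 * V) := by
  rw [lt_smoothBound_iff] at hp
  have hu1 : (1 : ℝ) ≤ u := by exact_mod_cast hu
  have h : (2 : ℝ) ^ (132 * V / u : ℝ) ≤ (2 : ℝ) ^ ((132 * V : ℕ) : ℝ) := by
    push_cast
    exact Real.rpow_le_rpow_of_exponent_le (by norm_num) (div_le_self (by positivity) hu1)
  rw [Real.rpow_natCast] at h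
  exact_mod_cast hp.trans h

lemma two_pow_rpow_div {V : ℕ} (hV : 0 < V) (u : ℕ) :
    (((2 ^ (132 * V) : ℕ) : ℝ)) ^ ((u : ℝ) / (4 * V)) = 2 ^ (33 * u) := by
  push_cast
  rw [← Real.rpow_natCast, ← Real.rpow_mul (by norm_num), ← Real.rpow_natCast]
  congr 1
  push_cast
  field_simp
  ring

/-- A pointwise bound for `τ(n)` by short divisor sums over smooth moduli. -/
lemma exists_card_divisors_le_sum_kernelSum : ∃ K : ℝ, 0 < K ∧ ∀ V n : ℕ, 0 < V → n ≠ 0 →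
    n ≤ (2 ^ (132 * V)) ^ 32 →
    (n.divisors.card : ℝ) ≤ K * (kernelSum 0 (smoothBound V 1) ((2 ^ (132 * V)) ^ 2) n +
      ∑ u ∈ Finset.Icc 1 V, (1 / 2 : ℝ) ^ u *
        kernelSum (u / (4 * V)) (smoothBound V u) ((2 ^ (132 * V)) ^ 2) n +
      kernelSum (V / (4 * V)) (smoothBound V V) ((2 ^ (132 * V)) ^ 2) n) := by
  obtain ⟨C, hC1, hC⟩ := exists_card_divisors_le_rpow (ε := 1 / 128) (by norm_num)
  refine ⟨2 ^ 32 + C, by positivity, fun V n hV hn hnX ↦ ?_⟩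
  set X := 2 ^ (132 * V) with hXdef
  have hX1 : 1 < X := Nat.one_lt_two_pow (by omega)
  have hX0 : 0 < X := by omega
  have hk (u : ℕ) : 0 ≤ kernelSum (u / (4 * V)) (smoothBound V u) (X ^ 2) n :=
    kernelSum_nonneg (by positivity) _ _ _
  have hk0 : 0 ≤ kernelSum 0 (smoothBound V 1) (X ^ 2) n := kernelSum_nonneg le_rfl _ _ _
  have hsum0 : 0 ≤ ∑ u ∈ Finset.Icc 1 V, (1 / 2 : ℝ) ^ u *
      kernelSum (u / (4 * V)) (smoothBound V u) (X ^ 2) n :=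
    Finset.sum_nonneg fun u _ ↦ mul_nonneg (by positivity) (hk u)
  rcases le_or_gt (smoothPart (smoothBound V 1) n) X with h1 | h1
  · have ha := card_divisors_le_smoothPart hn hX1 hnX
      (fun p hp ↦ le_pow_of_smoothBound_le one_pos hp)
    have hb := card_divisors_mul_rpow_le_kernelSum (α := 0) le_rfl (Y := X ^ 2) hn
      (smoothPart_dvd (smoothBound V 1) hn) (h1.trans (Nat.le_self_pow two_ne_zero X))
      (smoothPart_mem _ n)
    rw [Real.rpow_zero, mul_one] at hb
    calc (n.divisors.card : ℝ) ≤ 2 ^ 32 * (smoothPart (smoothBound V 1) n).divisors.card := by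
          exact_mod_cast ha
      _ ≤ (2 ^ 32 + C) * (kernelSum 0 (smoothBound V 1) (X ^ 2) n) := by
          gcongr; linarith
      _ ≤ _ := by gcongr; linarith [hk V]
  rcases le_or_gt (smoothPart (smoothBound V V) n) X with hV1 | hV1
  · obtain ⟨u, hu1, huV, hu, hu'⟩ : ∃ u, 1 ≤ u ∧ u < V ∧ X < smoothPart (smoothBound V u) n ∧
        smoothPart (smoothBound V (u + 1)) n ≤ X := by
      by_contra! hcon
      have : ∀ u, 1 ≤ u → u ≤ V → X < smoothPart (smoothBound V u) n := by
        intro u hu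
        induction u, hu using Nat.le_induction with
        | base => exact fun _ ↦ h1
        | succ u hu ih => exact fun huV ↦ hcon u hu huV (ih (by omega))
      exact absurd (this V hV le_rfl) (by omega)
    have ha := card_divisors_le_smoothPart hn hX1 hnX
      (fun p hp ↦ le_pow_of_smoothBound_le (Nat.succ_pos u) hp)
    have hb := card_divisors_mul_rpow_le_kernelSum_of_lt (α := u / (4 * V)) (by positivity) hn hX0
      (fun p hp ↦ le_pow_of_lt_smoothBound hu1 hp)
      (smoothPart_dvd_smoothPart (smoothBound_antitone V hu1 (Nat.le_succ u)) n) hu' hu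
    rw [hXdef, two_pow_rpow_div hV, ← hXdef] at hb
    have hterm : (1 / 2 : ℝ) ^ u * kernelSum (u / (4 * V)) (smoothBound V u) (X ^ 2) n ≤
        ∑ u ∈ Finset.Icc 1 V, (1 / 2 : ℝ) ^ u *
          kernelSum (u / (4 * V)) (smoothBound V u) (X ^ 2) n :=
      Finset.single_le_sum (f := fun u : ℕ ↦ (1 / 2 : ℝ) ^ u *
          kernelSum (u / (4 * V)) (smoothBound V u) (X ^ 2) n)
        (fun u _ ↦ mul_nonneg (by positivity) (hk u)) (Finset.mem_Icc.2 ⟨hu1, huV.le⟩)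
    calc (n.divisors.card : ℝ)
        ≤ 2 ^ (32 * (u + 1)) * (smoothPart (smoothBound V (u + 1)) n).divisors.card := by
          exact_mod_cast ha
      _ = 2 ^ 32 * (1 / 2 : ℝ) ^ u *
          ((smoothPart (smoothBound V (u + 1)) n).divisors.card * 2 ^ (33 * u)) := by
          rw [one_div, inv_pow, mul_add, pow_add, show 33 * u = 32 * u + u by ring, pow_add]
          field_simp
          ring
      _ ≤ 2 ^ 32 * (1 / 2 : ℝ) ^ u *
          kernelSum (u / (4 * V)) (smoothBound V u) (X ^ 2) n := by gcongr
      _ = 2 ^ 32 * ((1 / 2 : ℝ) ^ u *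
          kernelSum (u / (4 * V)) (smoothBound V u) (X ^ 2) n) := by ring
      _ ≤ (2 ^ 32 + C) * ∑ u ∈ Finset.Icc 1 V, (1 / 2 : ℝ) ^ u *
          kernelSum (u / (4 * V)) (smoothBound V u) (X ^ 2) n :=
          mul_le_mul (by linarith) hterm (mul_nonneg (by positivity) (hk u)) (by positivity)
      _ ≤ _ := by gcongr; linarith [hk V]
  · have hb := card_divisors_mul_rpow_le_kernelSum_of_lt (α := V / (4 * V)) (by positivity) hn hX0
      (fun p hp ↦ le_pow_of_lt_smoothBound hV hp) (one_dvd _) hX1.le hV1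
    rw [Nat.divisors_one, Finset.card_singleton, Nat.cast_one, one_mul] at hb
    calc (n.divisors.card : ℝ) ≤ C * (n : ℝ) ^ (1 / 128 : ℝ) := hC n
      _ ≤ C * (((X ^ 32 : ℕ)) : ℝ) ^ (1 / 128 : ℝ) := by gcongr
      _ = C * (X : ℝ) ^ ((V : ℝ) / (4 * V)) := by
          push_cast
          rw [← Real.rpow_natCast, ← Real.rpow_mul (by positivity)]
          congr 2
          field_simp
          norm_num
      _ ≤ (2 ^ 32 + C) * kernelSum (V / (4 * V)) (smoothBound V V) (X ^ 2) n := by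
          gcongr; linarith
      _ ≤ _ := by gcongr; linarith

lemma card_Ioc_filter_modEq_le (c L v : ℕ) {m : ℕ} (hm : 0 < m) :
    ((Finset.Ioc c (c + L)).filter fun a ↦ a ≡ v [MOD m]).card ≤ L / m + 1 := by
  have h := Nat.Ioc_filter_modEq_card c (c + L) hm v
  set k := ((Finset.Ioc c (c + L)).filter fun a ↦ a ≡ v [MOD m]).card with hk
  have hm' : (0 : ℚ) < m := by exact_mod_cast hm
  have h1 : (⌊(((c + L : ℕ) : ℚ) - v) / m⌋ - ⌊((c : ℚ) - v) / m⌋ : ℤ) < (L / m + 1 : ℚ) := by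
    have ha := Int.floor_le ((((c + L : ℕ) : ℚ) - v) / m)
    have hb := Int.lt_floor_add_one (((c : ℚ) - v) / m)
    have hc : (((c + L : ℕ) : ℚ) - v) / m = ((c : ℚ) - v) / m + L / m := by push_cast; ring
    push_cast at *
    linarith
  have h2 : (k : ℚ) < L / m + 1 := by
    have h3 : ((k : ℤ) : ℚ) < L / m + 1 := by
      rw [h]
      push_cast at *
      exact max_lt h1 (by positivity)
    exact_mod_cast h3
  rcases Nat.eq_zero_or_pos k with h0 | h0
  · rw [h0]; exact Nat.zero_le _
  have h4 : ((k - 1 : ℕ) : ℚ) * m < L := by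
    rw [← lt_div_iff₀ hm', Nat.cast_sub h0]
    push_cast
    linarith
  have h5 : k - 1 ≤ L / m := (Nat.le_div_iff_mul_le hm).2 (by exact_mod_cast h4.le)
  omega

lemma coprime_of_dvd_pow_sub_pow {a b m : ℕ} (hab : a ≤ b) (hc : a.Coprime b)
    (hm : m ∣ b ^ 4 - a ^ 4) : b.Coprime m := by
  have h1 : b.gcd m ∣ a ^ 4 := by
    have h2 : b.gcd m ∣ b ^ 4 := (Nat.gcd_dvd_left b m).trans (dvd_pow_self b (by norm_num))
    have h3 := Nat.dvd_sub h2 ((Nat.gcd_dvd_right b m).trans hm)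
    rwa [Nat.sub_sub_self (Nat.pow_le_pow_left hab 4)] at h3
  have h4 : (b.gcd m).Coprime (a ^ 4) :=
    Nat.Coprime.pow_right 4 (hc.symm.coprime_dvd_left (Nat.gcd_dvd_left b m))
  exact h4.eq_one_of_dvd h1

lemma card_Ioc_filter_dvd_le (b c L : ℕ) {m : ℕ} (hm : 0 < m) :
    ((Finset.Ioc c (c + L)).filter fun a ↦ (a < b ∧ a.Coprime b) ∧ m ∣ b ^ 4 - a ^ 4).card ≤
      (L / m + 1) * quarticRootCount m := by
  have : NeZero m := ⟨hm.ne'⟩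
  set s := (Finset.Ioc c (c + L)).filter fun a ↦ (a < b ∧ a.Coprime b) ∧ m ∣ b ^ 4 - a ^ 4
  have hfin : Fintype {u : (ZMod m)ˣ // u ^ 4 = 1} := Fintype.ofFinite _
  let t : Finset (ZMod m) :=
    (Finset.univ : Finset {u : (ZMod m)ˣ // u ^ 4 = 1}).image fun u ↦ (u.1 : ZMod m)
  have ht : t.card ≤ quarticRootCount m := by
    rw [quarticRootCount, Nat.card_eq_fintype_card]
    exact Finset.card_image_le
  have hprop : ∀ a ∈ s, b.Coprime m := fun a ha ↦ by
    have := (Finset.mem_filter.1 ha).2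
    exact coprime_of_dvd_pow_sub_pow this.1.1.le this.1.2 this.2
  refine (Finset.card_le_mul_card_image_of_maps_to (f := fun a : ℕ ↦ (a : ZMod m) * (b : ZMod m)⁻¹)
    (t := t) (fun a ha ↦ ?_) (L / m + 1) fun v hv ↦ ?_).trans (Nat.mul_le_mul_left _ ht)
  · have hbm := hprop a ha
    obtain ⟨⟨hab, hc⟩, hd⟩ := (Finset.mem_filter.1 ha).2
    have hpow : ((a : ZMod m)) ^ 4 = (b : ZMod m) ^ 4 := by
      have h1 := (ZMod.natCast_eq_zero_iff _ _).2 hd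
      rw [Nat.cast_sub (Nat.pow_le_pow_left hab.le 4), sub_eq_zero] at h1
      push_cast at h1
      exact h1.symm
    have hmul : (b : ZMod m) * (b : ZMod m)⁻¹ = 1 := ZMod.coe_mul_inv_eq_one b hbm
    have hone : ((a : ZMod m) * (b : ZMod m)⁻¹) ^ 4 = 1 := by
      rw [mul_pow, hpow, ← mul_pow, hmul, one_pow]
    refine Finset.mem_image.2 ⟨⟨Units.ofPowEqOne _ 4 hone (by norm_num), ?_⟩, Finset.mem_univ _, rfl⟩
    exact Units.pow_ofPowEqOne hone (by norm_num)
  · rcases (s.filter fun a : ℕ ↦ (a : ZMod m) * (b : ZMod m)⁻¹ = v).eq_empty_or_nonempty with h | ⟨a₀, h₀⟩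
    · rw [h]; simp
    obtain ⟨h₀s, h₀v⟩ := Finset.mem_filter.1 h₀
    have hmul : (b : ZMod m)⁻¹ * (b : ZMod m) = 1 := by
      rw [mul_comm]; exact ZMod.coe_mul_inv_eq_one b (hprop a₀ h₀s)
    refine (Finset.card_le_card fun a ha ↦ ?_).trans (card_Ioc_filter_modEq_le c L a₀ hm)
    obtain ⟨has, hav⟩ := Finset.mem_filter.1 ha
    refine Finset.mem_filter.2 ⟨(Finset.mem_filter.1 has).1, (ZMod.natCast_eq_natCast_iff _ _ _).1 ?_⟩
    have := congrArg (· * (b : ZMod m)) (hav.trans h₀v.symm)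
    simpa [mul_assoc, hmul] using this

lemma sum_kernelSum_le {α : ℝ} (hα : 0 ≤ α) (w b c : ℕ) {L Y : ℕ} (hY : Y ≤ L) :
    ∑ a ∈ (Finset.Ioc c (c + L)).filter (fun a ↦ a < b ∧ a.Coprime b),
      kernelSum α w Y (b ^ 4 - a ^ 4) ≤
    2 * L * ∑ m ∈ (Finset.Icc 1 Y).filter (fun m ↦ m ∈ w.smoothNumbers), localWeight α m := by
  set s := (Finset.Ioc c (c + L)).filter fun a ↦ a < b ∧ a.Coprime b with hs
  set T := (Finset.Icc 1 Y).filter fun m ↦ m ∈ w.smoothNumbers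
  calc ∑ a ∈ s, kernelSum α w Y (b ^ 4 - a ^ 4)
      ≤ ∑ a ∈ s, ∑ m ∈ T, if m ∣ b ^ 4 - a ^ 4 then tauKernel α m else 0 := by
        refine Finset.sum_le_sum fun a _ ↦ ?_
        rw [← Finset.sum_filter, kernelSum]
        refine Finset.sum_le_sum_of_subset_of_nonneg (fun m hm ↦ ?_)
          fun _ _ _ ↦ tauKernel_nonneg hα _
        obtain ⟨h1, h2, h3⟩ := Finset.mem_filter.1 hm
        simp only [T, Finset.mem_filter, Finset.mem_Icc]
        exact ⟨⟨⟨Nat.pos_of_mem_divisors h1, h2⟩, h3⟩, Nat.dvd_of_mem_divisors h1⟩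
    _ = ∑ m ∈ T, (s.filter fun a ↦ m ∣ b ^ 4 - a ^ 4).card * tauKernel α m := by
        rw [Finset.sum_comm]
        refine Finset.sum_congr rfl fun m _ ↦ ?_
        rw [← Finset.sum_filter, Finset.sum_const, nsmul_eq_mul]
    _ ≤ ∑ m ∈ T, 2 * L * localWeight α m := by
        refine Finset.sum_le_sum fun m hm ↦ ?_
        obtain ⟨hm1, hmY⟩ := Finset.mem_Icc.1 (Finset.mem_filter.1 hm).1
        have hcard := card_Ioc_filter_dvd_le b c L hm1
        rw [← Finset.filter_filter, ← hs] at hcard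
        have hm0 : (0 : ℝ) < m := by exact_mod_cast hm1
        have hmL : (m : ℝ) ≤ L := by exact_mod_cast hmY.trans hY
        have h2 : (((s.filter fun a ↦ m ∣ b ^ 4 - a ^ 4).card : ℕ) : ℝ) ≤
            (2 * L / m) * quarticRootCount m := by
          calc (((s.filter fun a ↦ m ∣ b ^ 4 - a ^ 4).card : ℕ) : ℝ)
              ≤ (((L / m : ℕ) : ℝ) + 1) * quarticRootCount m := by exact_mod_cast hcard
            _ ≤ (2 * L / m) * quarticRootCount m := by
              gcongr
              have h3 : ((L / m : ℕ) : ℝ) ≤ L / m := Nat.cast_div_le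
              have h4 : (1 : ℝ) ≤ L / m := (one_le_div hm0).2 hmL
              rw [mul_div_assoc]
              linarith
        calc _ ≤ (2 * L / m) * quarticRootCount m * tauKernel α m :=
              mul_le_mul_of_nonneg_right h2 (tauKernel_nonneg hα m)
          _ = _ := by rw [localWeight]; ring
    _ = _ := by rw [Finset.mul_sum]

lemma smoothBound_le_two_mul (V u : ℕ) :
    (smoothBound V u : ℝ) ≤ 2 * (2 : ℝ) ^ (132 * V / u : ℝ) := by
  have h1 : (1 : ℝ) ≤ (2 : ℝ) ^ (132 * V / u : ℝ) :=
    Real.one_le_rpow (by norm_num) (by positivity)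
  have h2 := Nat.floor_le (a := (2 : ℝ) ^ (132 * V / u : ℝ)) (by positivity)
  rw [smoothBound]
  push_cast
  linarith

lemma three_le_smoothBound {V u : ℕ} (hu : 0 < u) (huV : u ≤ V) : 3 ≤ smoothBound V u := by
  have hu0 : (0 : ℝ) < u := by exact_mod_cast hu
  have huV' : (u : ℝ) ≤ V := by exact_mod_cast huV
  have h : 2 < smoothBound V u := by
    rw [lt_smoothBound_iff]
    have h1 : (1 : ℝ) ≤ 132 * V / u := by rw [le_div_iff₀ hu0]; linarith
    simpa using Real.rpow_le_rpow_of_exponent_le (x := 2) (by norm_num) h1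
  exact h

lemma mul_log_smoothBound_le {V u : ℕ} (hu : 0 < u) (huV : u ≤ V) :
    (u : ℝ) / (4 * V) * Real.log (smoothBound V u) ≤ 34 := by
  have hu0 : (0 : ℝ) < u := by exact_mod_cast hu
  have huV' : (u : ℝ) ≤ V := by exact_mod_cast huV
  have hV0 : (0 : ℝ) < V := hu0.trans_le huV'
  have hs : (0 : ℝ) < smoothBound V u := by
    have := three_le_smoothBound hu huV
    exact_mod_cast (by omega : 0 < smoothBound V u)
  have h1 : Real.log (smoothBound V u) ≤ 1 + 132 * V / u := by
    have h2 := Real.log_le_log hs (smoothBound_le_two_mul V u)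
    rw [Real.log_mul (by norm_num) (by positivity), Real.log_rpow (by norm_num)] at h2
    have h3 : Real.log 2 ≤ 1 := by linarith [Real.log_two_lt_d9]
    have h4 : 132 * V / u * Real.log 2 ≤ 132 * V / u * 1 := by gcongr
    linarith
  calc (u : ℝ) / (4 * V) * Real.log (smoothBound V u) ≤ u / (4 * V) * (1 + 132 * V / u) := by gcongr
    _ = u / (4 * V) + 33 := by field_simp; ring
    _ ≤ 34 := by
      have : (u : ℝ) / (4 * V) ≤ 1 := by rw [div_le_one (by positivity)]; linarith
      linarith

lemma exists_sum_kernelSum_le : ∃ C : ℝ, 0 < C ∧ ∀ V u b c L Y : ℕ, 0 < u → u ≤ V →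
    2 ^ (132 * V) + 1 ≤ b → Y ≤ L → ∀ α : ℝ, 0 ≤ α → α ≤ u / (4 * V) →
    ∑ a ∈ (Finset.Ioc c (c + L)).filter (fun a ↦ a < b ∧ a.Coprime b),
      kernelSum α (smoothBound V u) Y (b ^ 4 - a ^ 4) ≤ C * L * Real.log b ^ 3 := by
  obtain ⟨C, hC0, hC⟩ := exists_sum_localWeight_le 34
  refine ⟨2 * C, by positivity, fun V u b c L Y hu huV hb hY α hα hαu ↦ ?_⟩
  have h3 := three_le_smoothBound hu huV
  have hlog1 := one_le_log_of_three_le h3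
  have hu0 : (0 : ℝ) < u := by exact_mod_cast hu
  have huV' : (u : ℝ) ≤ V := by exact_mod_cast huV
  have hV0 : (0 : ℝ) < V := hu0.trans_le huV'
  have hw : smoothBound V u ≤ b := by
    have := le_pow_of_lt_smoothBound (V := V) hu (Nat.sub_lt (by omega : 0 < smoothBound V u) one_pos)
    omega
  have hlog : Real.log (smoothBound V u) ≤ Real.log b := by gcongr
  refine (sum_kernelSum_le hα _ b c hY).trans ?_
  have h4 := hC (smoothBound V u) h3 α hα (hαu.trans ?_) (le_trans ?_ (mul_log_smoothBound_le hu huV))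
    ((Finset.Icc 1 Y).filter fun m ↦ m ∈ (smoothBound V u).smoothNumbers)
    fun m hm ↦ (Finset.mem_filter.1 hm).2
  · calc _ ≤ 2 * L * (C * Real.log (smoothBound V u) ^ 3) := by gcongr
      _ ≤ 2 * L * (C * Real.log b ^ 3) := by gcongr
      _ = _ := by ring
  · rw [div_le_div_iff₀ (by positivity) (by norm_num)]; linarith
  · gcongr

/-- Short-interval bound for the divisor function along the form `b ^ 4 - a ^ 4`. -/
lemma exists_sum_card_divisors_le : ∃ C : ℝ, 0 < C ∧ ∀ b L c : ℕ, 2 ≤ b → b ≤ L ^ 2 →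
    ∑ a ∈ (Finset.Ioc c (c + L)).filter (fun a ↦ a < b ∧ a.Coprime b),
      ((b ^ 4 - a ^ 4).divisors.card : ℝ) ≤ C * L * Real.log b ^ 3 := by
  obtain ⟨K, hK0, hK⟩ := exists_card_divisors_le_sum_kernelSum
  obtain ⟨C, hC0, hC⟩ := exists_sum_kernelSum_le
  obtain ⟨N, hN⟩ : ∃ N : ℕ, N = 528 := ⟨_, rfl⟩
  obtain ⟨M, hM⟩ : ∃ M : ℕ, M = (2 ^ N) ^ 4 := ⟨_, rfl⟩
  refine ⟨4 * K * C + 8 * M, by positivity, fun b L c hb hbL ↦ ?_⟩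
  set s := (Finset.Ioc c (c + L)).filter fun a ↦ a < b ∧ a.Coprime b with hs
  have hb2 : (2 : ℝ) ≤ b := by exact_mod_cast hb
  have hlog2 : 1 / 2 ≤ Real.log b := by
    have h1 := Real.log_le_log (by norm_num) hb2
    have h2 := Real.log_two_gt_d9
    linarith
  have hlog3 : (1 / 2) ^ 3 ≤ Real.log b ^ 3 := by gcongr
  have hn0 : ∀ a ∈ s, b ^ 4 - a ^ 4 ≠ 0 := fun a ha ↦ by
    have h1 := Nat.pow_lt_pow_left (Finset.mem_filter.1 ha).2.1 (n := 4) (by norm_num)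
    omega
  have hpos : 0 ≤ C * L * Real.log b ^ 3 := by positivity
  have hpow (u : ℕ) : (0 : ℝ) ≤ (1 / 2) ^ u := by positivity
  have hdiv (u v : ℕ) : (0 : ℝ) ≤ u / (4 * v) := by positivity
  have hposM : 0 ≤ 8 * M * L * Real.log b ^ 3 := by positivity
  set V := Nat.log 2 b / N with hV
  have hblt : b < 2 ^ (N * (V + 1)) :=
    (Nat.lt_pow_succ_log_self (by norm_num) b).trans_le
      (Nat.pow_le_pow_right (by norm_num) (by subst hN; omega))
  rcases Nat.eq_zero_or_pos V with hV0 | hV0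
  · rw [hV0, zero_add, mul_one] at hblt
    calc ∑ a ∈ s, ((b ^ 4 - a ^ 4).divisors.card : ℝ) ≤ ∑ a ∈ s, (M : ℝ) := by
          refine Finset.sum_le_sum fun a _ ↦ ?_
          rw [hM]
          refine Nat.cast_le.2 ((Nat.card_divisors_le_self _).trans ((Nat.sub_le _ _).trans ?_))
          exact Nat.pow_le_pow_left hblt.le 4
      _ ≤ L * M := by
          rw [Finset.sum_const, nsmul_eq_mul]
          gcongr
          simpa using Finset.card_filter_le (Finset.Ioc c (c + L)) fun a ↦ a < b ∧ a.Coprime b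
      _ = 8 * M * L * (1 / 2) ^ 3 := by ring
      _ ≤ (4 * K * C + 8 * M) * L * Real.log b ^ 3 := by
          gcongr
          have : 0 < 4 * K * C := by positivity
          linarith
  clear hM
  subst hN
  set X := 2 ^ (132 * V) with hX
  have hX1 : 1 < X := Nat.one_lt_two_pow (by omega)
  have hX4 : X ^ 4 ≤ b := by
    rw [hX, ← pow_mul]
    exact Nat.pow_le_of_le_log (by omega) (by omega)
  have hXL : X ^ 2 ≤ L := by
    rw [← Nat.pow_le_pow_iff_left (two_ne_zero), ← pow_mul]
    exact hX4.trans hbL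
  have hbX : b ≤ X ^ 8 := by
    rw [hX, ← pow_mul]
    exact hblt.le.trans (Nat.pow_le_pow_right (by norm_num) (by omega))
  have hXb : X + 1 ≤ b := by
    have : X + 1 ≤ X ^ 4 := by
      have h1 : X * 2 ≤ X * X ^ 3 := Nat.mul_le_mul_left _ (hX1.trans_le (Nat.le_self_pow (by norm_num) X))
      have h2 : X * X ^ 3 = X ^ 4 := by ring
      omega
    exact this.trans hX4
  have hpt : ∀ a ∈ s, ((b ^ 4 - a ^ 4).divisors.card : ℝ) ≤ _ := fun a ha ↦
    hK V (b ^ 4 - a ^ 4) hV0 (hn0 a ha) (by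
      rw [← hX]
      calc b ^ 4 - a ^ 4 ≤ b ^ 4 := Nat.sub_le _ _
        _ ≤ (X ^ 8) ^ 4 := Nat.pow_le_pow_left hbX 4
        _ = X ^ 32 := by ring)
  refine (Finset.sum_le_sum hpt).trans ?_
  rw [← Finset.mul_sum, Finset.sum_add_distrib, Finset.sum_add_distrib, Finset.sum_comm]
  simp_rw [← Finset.mul_sum]
  have hgeom : ∑ u ∈ Finset.Icc 1 V, (1 / 2 : ℝ) ^ u ≤ 2 := by
    refine le_trans (Finset.sum_le_sum_of_subset_of_nonneg (fun u hu ↦ ?_)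
      fun u _ _ ↦ hpow u) (sum_geometric_two_le (V + 1))
    have := (Finset.mem_Icc.1 hu).2
    exact Finset.mem_range.2 (by omega)
  have h1 := hC V 1 b c L (X ^ 2) one_pos hV0 hXb hXL 0 le_rfl (hdiv 1 V)
  have h2 : ∀ u ∈ Finset.Icc 1 V, _ := fun u hu ↦
    hC V u b c L (X ^ 2) (Finset.mem_Icc.1 hu).1 (Finset.mem_Icc.1 hu).2 hXb hXL (u / (4 * V))
      (hdiv u V) le_rfl
  have h3 := h2 V (Finset.mem_Icc.2 ⟨hV0, le_rfl⟩)
  have h4 := Finset.sum_le_sum fun u hu ↦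
    mul_le_mul_of_nonneg_left (h2 u hu) (hpow u)
  have h5 := mul_le_mul_of_nonneg_right hgeom hpos
  rw [← Finset.sum_mul] at h4
  calc _ ≤ K * (C * L * Real.log b ^ 3 + 2 * (C * L * Real.log b ^ 3) + C * L * Real.log b ^ 3) :=
        mul_le_mul_of_nonneg_left (add_le_add (add_le_add h1 (h4.trans h5)) h3) hK0.le
    _ ≤ _ := by linarith

lemma sum_rpow_neg_third_le (n : ℕ) :
    ∑ k ∈ Finset.Ioc 0 n, (k : ℝ) ^ (-(1 / 3) : ℝ) ≤ 3 / 2 * (n : ℝ) ^ (2 / 3 : ℝ) := by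
  induction n with
  | zero => simp
  | succ n ih =>
    rw [Finset.sum_Ioc_succ_top (Nat.zero_le n)]
    refine (add_le_add_left ih _).trans ?_
    set s := ((n + 1 : ℕ) : ℝ) ^ (1 / 3 : ℝ) with hs
    set t := (n : ℝ) ^ (1 / 3 : ℝ) with ht
    have hs0 : 0 < s := by positivity
    have ht0 : 0 ≤ t := by positivity
    have hts : t ≤ s := by rw [hs, ht]; gcongr; omega
    have hs3 : s ^ 3 = n + 1 := by
      rw [hs, ← Real.rpow_natCast, ← Real.rpow_mul (by positivity)]; norm_num
    have ht3 : t ^ 3 = n := by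
      rw [ht, ← Real.rpow_natCast, ← Real.rpow_mul (by positivity)]; norm_num
    have hs2 : ((n + 1 : ℕ) : ℝ) ^ (2 / 3 : ℝ) = s ^ 2 := by
      rw [hs, ← Real.rpow_natCast, ← Real.rpow_mul (by positivity)]; norm_num
    have ht2 : (n : ℝ) ^ (2 / 3 : ℝ) = t ^ 2 := by
      rw [ht, ← Real.rpow_natCast, ← Real.rpow_mul (by positivity)]; norm_num
    have hs1 : ((n + 1 : ℕ) : ℝ) ^ (-(1 / 3) : ℝ) = 1 / s := by
      rw [hs, one_div (_ ^ _), Real.rpow_neg (by positivity)]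
    rw [hs1, hs2, ht2]
    have h1 : 1 / s ≤ 3 / 2 * (s ^ 2 - t ^ 2) := by
      rw [div_le_iff₀ hs0]
      have h2 : 0 ≤ (s - t) * (s - t) * (s + 2 * t) :=
        mul_nonneg (mul_self_nonneg _) (by positivity)
      nlinarith
    linarith

lemma sum_mul_rpow_neg_third_le {g : ℕ → ℝ} {L : ℕ} {M D : ℝ} (hg : ∀ w, 0 ≤ g w)
    (hL : 0 < L) (hD : ∀ w, g w ≤ D) (hM : ∀ c, ∑ w ∈ Finset.Ioc c (c + L), g w ≤ M * L) (n : ℕ) :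
    ∑ w ∈ Finset.Ioc 0 ((n + 1) * L), g w * (w : ℝ) ^ (-(1 / 3) : ℝ) ≤
      3 / 2 * D * (L : ℝ) ^ (2 / 3 : ℝ) +
        M * (L : ℝ) ^ (2 / 3 : ℝ) * ∑ k ∈ Finset.Ioc 0 n, (k : ℝ) ^ (-(1 / 3) : ℝ) := by
  have hL0 : (0 : ℝ) < L := by exact_mod_cast hL
  induction n with
  | zero =>
    rw [zero_add, one_mul, Finset.Ioc_self, Finset.sum_empty, mul_zero, add_zero]
    have hD0 : 0 ≤ D := (hg 0).trans (hD 0)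
    calc _ ≤ ∑ w ∈ Finset.Ioc 0 L, D * (w : ℝ) ^ (-(1 / 3) : ℝ) := by
          gcongr with w hw; exact hD w
      _ ≤ D * (3 / 2 * (L : ℝ) ^ (2 / 3 : ℝ)) := by
          rw [← Finset.mul_sum]
          gcongr
          exact sum_rpow_neg_third_le L
      _ = _ := by ring
  | succ n ih =>
    rw [← Finset.sum_Ioc_consecutive _ (Nat.zero_le _)
      (Nat.mul_le_mul_right L (Nat.le_succ (n + 1))), Finset.sum_Ioc_succ_top (Nat.zero_le n),
      mul_add, ← add_assoc]
    refine add_le_add ih ?_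
    have hk0 : (0 : ℝ) < ((n + 1 : ℕ) : ℝ) := by positivity
    rw [Nat.succ_mul (n + 1)]
    calc _ ≤ ∑ w ∈ Finset.Ioc ((n + 1) * L) ((n + 1) * L + L),
            g w * (((n + 1 : ℕ) : ℝ) * L) ^ (-(1 / 3) : ℝ) := by
          refine Finset.sum_le_sum fun w hw ↦ mul_le_mul_of_nonneg_left ?_ (hg w)
          refine Real.rpow_le_rpow_of_nonpos (by positivity) ?_ (by norm_num)
          exact_mod_cast (Finset.mem_Ioc.1 hw).1.le
      _ ≤ M * L * (((n + 1 : ℕ) : ℝ) * L) ^ (-(1 / 3) : ℝ) := by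
          rw [← Finset.sum_mul]
          exact mul_le_mul_of_nonneg_right (hM _) (by positivity)
      _ = _ := by
          rw [Real.mul_rpow hk0.le hL0.le]
          have h1 : (L : ℝ) ^ (2 / 3 : ℝ) = L * (L : ℝ) ^ (-(1 / 3) : ℝ) := by
            conv_rhs => rw [← Real.rpow_one_add' hL0.le (by norm_num)]
            norm_num
          rw [h1]; ring

lemma sum_mul_rpow_neg_third_le_of_le {g : ℕ → ℝ} {L : ℕ} {M D H : ℝ} (hg : ∀ w, 0 ≤ g w)
    (hL : 0 < L) (hM0 : 0 ≤ M) (hD : ∀ w, g w ≤ D)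
    (hM : ∀ c, ∑ w ∈ Finset.Ioc c (c + L), g w ≤ M * L) (hH : 0 < H) {T : Finset ℕ}
    (hT : ∀ w ∈ T, 0 < w ∧ (w : ℝ) ≤ H) :
    ∑ w ∈ T, g w * (w : ℝ) ^ (-(1 / 3) : ℝ) ≤
      3 / 2 * (M * H ^ (2 / 3 : ℝ) + D * (L : ℝ) ^ (2 / 3 : ℝ)) := by
  have hL0 : (0 : ℝ) < L := by exact_mod_cast hL
  have hN : 0 < ⌈H / L⌉₊ := Nat.ceil_pos.2 (by positivity)
  obtain ⟨n, hn⟩ : ∃ n, ⌈H / L⌉₊ = n + 1 := ⟨⌈H / L⌉₊ - 1, by omega⟩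
  have hn1 : (n : ℝ) ≤ H / L := by
    have h := Nat.ceil_lt_add_one (a := H / L) (by positivity)
    rw [hn] at h
    push_cast at h
    linarith
  have hn2 : H ≤ ((n + 1) * L : ℕ) := by
    have h := Nat.le_ceil (H / L)
    rw [hn, div_le_iff₀ hL0] at h
    push_cast at h ⊢
    exact h
  calc _ ≤ ∑ w ∈ Finset.Ioc 0 ((n + 1) * L), g w * (w : ℝ) ^ (-(1 / 3) : ℝ) := by
        refine Finset.sum_le_sum_of_subset_of_nonneg (fun w hw ↦ ?_)
          fun w _ _ ↦ mul_nonneg (hg w) (by positivity)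
        exact Finset.mem_Ioc.2 ⟨(hT w hw).1, by exact_mod_cast (hT w hw).2.trans hn2⟩
    _ ≤ _ := sum_mul_rpow_neg_third_le hg hL hD hM n
    _ ≤ 3 / 2 * D * (L : ℝ) ^ (2 / 3 : ℝ) +
        M * (L : ℝ) ^ (2 / 3 : ℝ) * (3 / 2 * (H / L) ^ (2 / 3 : ℝ)) := by
        gcongr
        exact (sum_rpow_neg_third_le n).trans (by gcongr)
    _ = _ := by
        rw [Real.div_rpow hH.le hL0.le]
        field_simp
        ring

/-- `τ(b ^ 4 - a ^ 4)` restricted to coprime pairs `a < b`. -/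
noncomputable def coprimeTau (b a : ℕ) : ℝ :=
  if a < b ∧ a.Coprime b then ((b ^ 4 - a ^ 4).divisors.card : ℝ) else 0

lemma coprimeTau_nonneg (b a : ℕ) : 0 ≤ coprimeTau b a := by
  rw [coprimeTau]; split_ifs <;> positivity

lemma exists_sum_coprimeTau_mul_rpow_le : ∃ C : ℝ, 0 < C ∧ ∀ b : ℕ, 2 ≤ b → ∀ y : ℝ, 0 < y →
    ∀ T : Finset ℕ, (∀ a ∈ T, 0 < a ∧ y * min (a : ℝ) ((b : ℝ) - a) < b) →
    ∑ a ∈ T, coprimeTau b a * ((b : ℝ) - a) ^ (-(1 / 3) : ℝ) ≤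
      C * ((b / y) ^ (2 / 3 : ℝ) * Real.log b ^ 3 + (b : ℝ) ^ (2 / 5 : ℝ)) := by
  obtain ⟨C, hC0, hC⟩ := exists_sum_card_divisors_le
  obtain ⟨E, hE1, hE⟩ := exists_card_divisors_le_rpow (ε := 1 / 60) (by norm_num)
  refine ⟨3 * C + 6 * E, by positivity, fun b hb y hy T hT ↦ ?_⟩
  have hb1 : (1 : ℝ) ≤ b := by exact_mod_cast (by omega : 1 ≤ b)
  have hb0 : (0 : ℝ) < b := by linarith
  have hlog : 0 ≤ Real.log b := Real.log_nonneg hb1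
  set L := Nat.sqrt b + 1 with hL
  have hLb : b ≤ L ^ 2 := by
    rw [hL, sq]
    exact (Nat.lt_succ_sqrt b).le
  have hL2 : (L : ℝ) ≤ 2 * (b : ℝ) ^ (1 / 2 : ℝ) := by
    have h1 : (Nat.sqrt b : ℝ) ≤ (b : ℝ) ^ (1 / 2 : ℝ) := by
      rw [← Real.sqrt_eq_rpow]; exact Real.nat_sqrt_le_real_sqrt
    have h2 : 1 ≤ (b : ℝ) ^ (1 / 2 : ℝ) := Real.one_le_rpow hb1 (by norm_num)
    rw [hL]
    push_cast
    linarith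
  have hL0 : 0 < L := Nat.succ_pos _
  have hL3 : (L : ℝ) ^ (2 / 3 : ℝ) ≤ 2 * (b : ℝ) ^ (1 / 3 : ℝ) := by
    calc (L : ℝ) ^ (2 / 3 : ℝ) ≤ (2 * (b : ℝ) ^ (1 / 2 : ℝ)) ^ (2 / 3 : ℝ) := by gcongr
      _ = (2 : ℝ) ^ (2 / 3 : ℝ) * (b : ℝ) ^ (1 / 3 : ℝ) := by
        rw [Real.mul_rpow (by norm_num) (by positivity), ← Real.rpow_mul hb0.le]; norm_num
      _ ≤ 2 * (b : ℝ) ^ (1 / 3 : ℝ) := by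
        gcongr
        conv_rhs => rw [← Real.rpow_one 2]
        exact Real.rpow_le_rpow_of_exponent_le (by norm_num) (by norm_num)
  set D := E * (b : ℝ) ^ (1 / 15 : ℝ) with hDdef
  have hD (a : ℕ) : coprimeTau b a ≤ D := by
    rw [coprimeTau]
    split_ifs
    · calc _ ≤ E * ((b ^ 4 - a ^ 4 : ℕ) : ℝ) ^ (1 / 60 : ℝ) := hE _
        _ ≤ E * ((b ^ 4 : ℕ) : ℝ) ^ (1 / 60 : ℝ) := by gcongr; exact Nat.sub_le _ _
        _ = D := by
          rw [hDdef]
          push_cast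
          rw [← Real.rpow_natCast, ← Real.rpow_mul hb0.le]; norm_num
    · positivity
  have hblock (c : ℕ) : ∑ a ∈ Finset.Ioc c (c + L), coprimeTau b a ≤ C * Real.log b ^ 3 * L := by
    simp_rw [coprimeTau, ← Finset.sum_filter]
    exact (hC b L c hb hLb).trans_eq (by ring)
  let g : ℕ → ℝ := fun w ↦ if w < b then coprimeTau b (b - w) else 0
  have hgblock (c : ℕ) : ∑ w ∈ Finset.Ioc c (c + L), g w ≤ C * Real.log b ^ 3 * L := by
    simp_rw [g]
    rw [← Finset.sum_filter]
    calc _ = ∑ a ∈ ((Finset.Ioc c (c + L)).filter (· < b)).image (b - ·), coprimeTau b a := by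
          rw [Finset.sum_image]
          intro w hw w' hw' h
          simp only [Finset.coe_filter, Finset.mem_Ioc, Set.mem_ofPred_eq] at hw hw' h
          omega
      _ ≤ ∑ a ∈ Finset.Ioc (b - c - L - 1) (b - c - L - 1 + L), coprimeTau b a := by
          refine Finset.sum_le_sum_of_subset_of_nonneg (fun a ha ↦ ?_)
            fun a _ _ ↦ coprimeTau_nonneg b a
          obtain ⟨w, hw, rfl⟩ := Finset.mem_image.1 ha
          simp only [Finset.mem_filter, Finset.mem_Ioc] at hw ⊢
          omega
      _ ≤ _ := hblock _
  have hH : 0 < b / y := by positivity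
  have h1 := sum_mul_rpow_neg_third_le_of_le (coprimeTau_nonneg b) hL0
    (by positivity) hD hblock hH (T := (T.filter (· < b)).filter fun a : ℕ ↦ y * (a : ℝ) < b)
    fun a ha ↦ ⟨(hT a (Finset.mem_filter.1 (Finset.mem_filter.1 ha).1).1).1, by
      rw [le_div_iff₀ hy, mul_comm]; exact (Finset.mem_filter.1 ha).2.le⟩
  have h2 := sum_mul_rpow_neg_third_le_of_le (g := g) (D := D)
    (fun w ↦ by simp only [g]; split_ifs; exacts [coprimeTau_nonneg _ _, le_rfl])
    hL0 (by positivity)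
    (fun w ↦ by simp only [g]; split_ifs; exacts [hD _, by positivity]) hgblock hH
    (T := ((T.filter (· < b)).filter fun a : ℕ ↦ y * ((b : ℝ) - a) < b).image (b - ·))
    fun w hw ↦ by
      obtain ⟨a, ha, rfl⟩ := Finset.mem_image.1 hw
      have hab := (Finset.mem_filter.1 (Finset.mem_filter.1 ha).1).2
      refine ⟨by omega, ?_⟩
      rw [le_div_iff₀ hy, mul_comm, Nat.cast_sub hab.le]
      exact (Finset.mem_filter.1 ha).2.le
  rw [Finset.sum_image] at h2
  swap
  · intro a ha a' ha' h
    simp only [Finset.coe_filter, Finset.mem_filter, Set.mem_ofPred_eq] at ha ha' h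
    omega
  have hterm : ∀ a ∈ T.filter (· < b), coprimeTau b a * ((b : ℝ) - a) ^ (-(1 / 3) : ℝ) ≤
      (if y * (a : ℝ) < b then coprimeTau b a * (a : ℝ) ^ (-(1 / 3) : ℝ) else 0) +
      (if y * ((b : ℝ) - a) < b then g (b - a) * ((b - a : ℕ) : ℝ) ^ (-(1 / 3) : ℝ) else 0) := by
    intro a ha
    obtain ⟨haT, hab⟩ := Finset.mem_filter.1 ha
    obtain ⟨ha0, hmin⟩ := hT a haT
    have ha0' : (0 : ℝ) < a := by exact_mod_cast ha0
    have hgab : g (b - a) = coprimeTau b a := by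
      simp only [g]; rw [if_pos (by omega), Nat.sub_sub_self hab.le]
    have hsub : (0 : ℝ) < (b : ℝ) - a := by
      have : (a : ℝ) < b := by exact_mod_cast hab
      linarith
    rw [hgab, Nat.cast_sub hab.le]
    have hnn := coprimeTau_nonneg b a
    rcases le_total (a : ℝ) ((b : ℝ) - a) with h | h
    · rw [min_eq_left h] at hmin
      rw [if_pos hmin]
      have h3 : coprimeTau b a * ((b : ℝ) - a) ^ (-(1 / 3) : ℝ) ≤
          coprimeTau b a * (a : ℝ) ^ (-(1 / 3) : ℝ) :=
        mul_le_mul_of_nonneg_left (Real.rpow_le_rpow_of_nonpos ha0' h (by norm_num)) hnn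
      refine h3.trans (le_add_of_nonneg_right ?_)
      split_ifs <;> positivity
    · rw [min_eq_right h] at hmin
      rw [if_pos hmin]
      refine le_add_of_nonneg_left ?_
      split_ifs <;> positivity
  calc ∑ a ∈ T, coprimeTau b a * ((b : ℝ) - a) ^ (-(1 / 3) : ℝ)
      = ∑ a ∈ T.filter (· < b), coprimeTau b a * ((b : ℝ) - a) ^ (-(1 / 3) : ℝ) := by
        rw [Finset.sum_filter_of_ne]
        intro a _ h
        by_contra hab
        exact h (by rw [coprimeTau, if_neg (fun h ↦ hab h.1), zero_mul])
    _ ≤ 3 * C * ((b / y) ^ (2 / 3 : ℝ) * Real.log b ^ 3) + 3 * D * (L : ℝ) ^ (2 / 3 : ℝ) := by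
        refine (Finset.sum_le_sum hterm).trans ?_
        rw [Finset.sum_add_distrib, ← Finset.sum_filter, ← Finset.sum_filter]
        exact (add_le_add h1 h2).trans_eq (by ring)
    _ ≤ 3 * C * ((b / y) ^ (2 / 3 : ℝ) * Real.log b ^ 3) + 3 * D * (2 * (b : ℝ) ^ (1 / 3 : ℝ)) := by
        gcongr
    _ = 3 * C * ((b / y) ^ (2 / 3 : ℝ) * Real.log b ^ 3) + 6 * E * (b : ℝ) ^ (2 / 5 : ℝ) := by
        have h3 : (b : ℝ) ^ (2 / 5 : ℝ) = (b : ℝ) ^ (1 / 15 : ℝ) * (b : ℝ) ^ (1 / 3 : ℝ) := by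
          rw [← Real.rpow_add hb0]; norm_num
        rw [h3, hDdef]; ring
    _ ≤ _ := by
        have h3 : 0 ≤ E * ((b / y) ^ (2 / 3 : ℝ) * Real.log b ^ 3) := by positivity
        have h4 : 0 ≤ C * (b : ℝ) ^ (2 / 5 : ℝ) := by positivity
        linarith

/-- The contribution of a coprime pair `a < b` to the weighted divisor sum. -/
noncomputable def coprimeTerm (a b : ℕ) : ℝ :=
  coprimeTau b a * ((b : ℝ) - a) ^ (-(1 / 3) : ℝ) * (b : ℝ) ^ (-(5 / 3) : ℝ)

lemma coprimeTerm_of_le {a b : ℕ} (h : b ≤ a) : coprimeTerm a b = 0 := by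
  rw [coprimeTerm, coprimeTau, if_neg (fun h' ↦ by omega), zero_mul, zero_mul]

lemma coprimeTerm_nonneg (a b : ℕ) : 0 ≤ coprimeTerm a b := by
  rcases le_or_gt b a with h | h
  · rw [coprimeTerm_of_le h]
  · have h1 : (0 : ℝ) ≤ (b : ℝ) - a := sub_nonneg.2 (by exact_mod_cast h.le)
    have h2 := coprimeTau_nonneg b a
    rw [coprimeTerm]
    positivity

lemma exists_sum_coprimeTerm_le : ∃ C : ℝ, 0 < C ∧ ∀ x : ℝ, 2 ≤ x → ∀ y : ℝ, 0 < y →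
    ∑ q ∈ (Finset.Icc 1 ⌊x⌋₊ ×ˢ Finset.Icc 1 ⌊x⌋₊).filter
      (fun q : ℕ × ℕ ↦ y * min (q.1 : ℝ) ((q.2 : ℝ) - q.1) < q.2), coprimeTerm q.1 q.2 ≤
    C * (Real.log x ^ 4 * y ^ (-(2 : ℝ) / 3) + 1) := by
  obtain ⟨C, hC0, hC⟩ := exists_sum_coprimeTau_mul_rpow_le
  have hsum : Summable fun n : ℕ ↦ (n : ℝ) ^ (-(19 / 15) : ℝ) :=
    Real.summable_nat_rpow.2 (by norm_num)
  set Z := ∑' n : ℕ, (n : ℝ) ^ (-(19 / 15) : ℝ) with hZ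
  have hZ0 : 0 ≤ Z := tsum_nonneg fun n ↦ by positivity
  refine ⟨C * (3 + Z), by positivity, fun x hx y hy ↦ ?_⟩
  have hx0 : 0 < x := by linarith
  have hlog2 : 1 / 2 ≤ Real.log x := by
    have h1 := Real.log_le_log (by norm_num) hx
    have h2 := Real.log_two_gt_d9
    linarith
  set Y := y ^ (-(2 : ℝ) / 3) with hY
  have hY0 : 0 < Y := by positivity
  have hinner (b : ℕ) (hb : b ∈ Finset.Icc 1 ⌊x⌋₊) : ∑ a ∈ (Finset.Icc 1 ⌊x⌋₊).filter
      (fun a : ℕ ↦ y * min (a : ℝ) ((b : ℝ) - a) < b), coprimeTerm a b ≤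
      C * (Y * Real.log x ^ 3 * (b : ℝ)⁻¹ + (b : ℝ) ^ (-(19 / 15) : ℝ)) := by
    obtain ⟨hb1, hbx⟩ := Finset.mem_Icc.1 hb
    have hb0 : (0 : ℝ) < b := by exact_mod_cast hb1
    rcases hb1.eq_or_lt with rfl | hb2
    · rw [Finset.sum_eq_zero]
      · positivity
      · intro a ha
        exact coprimeTerm_of_le (Finset.mem_Icc.1 (Finset.mem_filter.1 ha).1).1
    have h1 := hC b hb2 y hy ((Finset.Icc 1 ⌊x⌋₊).filter
      fun a : ℕ ↦ y * min (a : ℝ) ((b : ℝ) - a) < b) fun a ha ↦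
      ⟨(Finset.mem_Icc.1 (Finset.mem_filter.1 ha).1).1, (Finset.mem_filter.1 ha).2⟩
    have h2 : Real.log b ≤ Real.log x := by
      gcongr
      exact (Nat.le_floor_iff hx0.le).1 hbx
    have h3 : 0 ≤ Real.log b := Real.log_nonneg (by exact_mod_cast hb1)
    simp_rw [coprimeTerm]
    rw [← Finset.sum_mul]
    calc _ ≤ C * ((b / y) ^ (2 / 3 : ℝ) * Real.log b ^ 3 + (b : ℝ) ^ (2 / 5 : ℝ)) *
          (b : ℝ) ^ (-(5 / 3) : ℝ) := mul_le_mul_of_nonneg_right h1 (by positivity)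
      _ = C * (Y * Real.log b ^ 3 * (b : ℝ)⁻¹ + (b : ℝ) ^ (-(19 / 15) : ℝ)) := by
        have h4 : (b : ℝ)⁻¹ = (b : ℝ) ^ (2 / 3 : ℝ) * (b : ℝ) ^ (-(5 / 3) : ℝ) := by
          rw [← Real.rpow_add hb0, ← Real.rpow_neg_one]; norm_num
        have h5 : (b : ℝ) ^ (-(19 / 15) : ℝ) = (b : ℝ) ^ (2 / 5 : ℝ) * (b : ℝ) ^ (-(5 / 3) : ℝ) := by
          rw [← Real.rpow_add hb0]; norm_num
        have h6 : ((b : ℝ) / y) ^ (2 / 3 : ℝ) = (b : ℝ) ^ (2 / 3 : ℝ) * Y := by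
          rw [Real.div_rpow hb0.le hy.le, hY, neg_div, Real.rpow_neg hy.le, div_eq_mul_inv]
        rw [h4, h5, h6]
        ring
      _ ≤ _ := by gcongr
  have hharm : ∑ b ∈ Finset.Icc 1 ⌊x⌋₊, (b : ℝ)⁻¹ ≤ 3 * Real.log x := by
    have h1 := harmonic_floor_le_one_add_log x (by linarith)
    rw [harmonic_eq_sum_Icc] at h1
    push_cast at h1
    linarith
  have hZle : ∑ b ∈ Finset.Icc 1 ⌊x⌋₊, (b : ℝ) ^ (-(19 / 15) : ℝ) ≤ Z :=
    hsum.sum_le_tsum _ fun n _ ↦ by positivity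
  rw [Finset.sum_filter, Finset.sum_product_right]
  simp_rw [← Finset.sum_filter]
  calc _ ≤ ∑ b ∈ Finset.Icc 1 ⌊x⌋₊,
        C * (Y * Real.log x ^ 3 * (b : ℝ)⁻¹ + (b : ℝ) ^ (-(19 / 15) : ℝ)) :=
        Finset.sum_le_sum hinner
    _ = C * (Y * Real.log x ^ 3 * ∑ b ∈ Finset.Icc 1 ⌊x⌋₊, (b : ℝ)⁻¹ +
        ∑ b ∈ Finset.Icc 1 ⌊x⌋₊, (b : ℝ) ^ (-(19 / 15) : ℝ)) := by
        rw [← Finset.mul_sum, Finset.sum_add_distrib, ← Finset.mul_sum]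
    _ ≤ C * (Y * Real.log x ^ 3 * (3 * Real.log x) + Z) := by gcongr
    _ ≤ _ := by
        have h1 : 0 ≤ C * Z * (Real.log x ^ 4 * Y) := by positivity
        linarith

lemma exists_sum_card_divisors_pow_four_le : ∃ C : ℝ, 0 < C ∧ ∀ N : ℕ,
    ∑ g ∈ Finset.Icc 1 N, ((g ^ 4).divisors.card : ℝ) / (g : ℝ) ^ 2 ≤ C := by
  obtain ⟨E, hE1, hE⟩ := exists_card_divisors_le_rpow (ε := 1 / 8) (by norm_num)
  have hsum : Summable fun n : ℕ ↦ (n : ℝ) ^ (-(3 / 2) : ℝ) :=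
    Real.summable_nat_rpow.2 (by norm_num)
  refine ⟨E * ∑' n : ℕ, (n : ℝ) ^ (-(3 / 2) : ℝ) + 1, ?_, fun N ↦ ?_⟩
  · have : 0 ≤ ∑' n : ℕ, (n : ℝ) ^ (-(3 / 2) : ℝ) := tsum_nonneg fun n ↦ by positivity
    positivity
  calc _ ≤ ∑ g ∈ Finset.Icc 1 N, E * (g : ℝ) ^ (-(3 / 2) : ℝ) := by
        refine Finset.sum_le_sum fun g hg ↦ ?_
        have hg0 : (0 : ℝ) < g := by exact_mod_cast (Finset.mem_Icc.1 hg).1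
        rw [div_le_iff₀ (by positivity), mul_assoc, ← Real.rpow_natCast (g : ℝ) 2,
          ← Real.rpow_add hg0]
        refine (hE _).trans_eq ?_
        push_cast
        rw [← Real.rpow_natCast, ← Real.rpow_mul hg0.le]
        norm_num
    _ ≤ _ := by
        rw [← Finset.mul_sum]
        have h1 := hsum.sum_le_tsum (Finset.Icc 1 N) fun n _ ↦ by positivity
        have h2 := mul_le_mul_of_nonneg_left h1 (by linarith : 0 ≤ E)
        linarith

lemma div_le_mul_coprimeTerm {a b g : ℕ} (hg : 0 < g) (hab : a < b) (hc : a.Coprime b) :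
    ((((b * g) ^ 4 - (a * g) ^ 4).divisors.card : ℕ) : ℝ) /
      (((b * g : ℕ) : ℝ) ^ (5 / 3 : ℝ) * (((b * g : ℕ) : ℝ) - ((a * g : ℕ) : ℝ)) ^ (1 / 3 : ℝ)) ≤
    ((g ^ 4).divisors.card : ℝ) / (g : ℝ) ^ 2 * coprimeTerm a b := by
  have hg0 : (0 : ℝ) < g := by exact_mod_cast hg
  have hb0 : (0 : ℝ) < b := by exact_mod_cast (Nat.zero_le a).trans_lt hab
  have hba : (0 : ℝ) < (b : ℝ) - a := sub_pos.2 (by exact_mod_cast hab)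
  have h1 : (b * g) ^ 4 - (a * g) ^ 4 = g ^ 4 * (b ^ 4 - a ^ 4) := by
    rw [mul_pow, mul_pow, ← Nat.sub_mul, mul_comm]
  have h2 : (((g ^ 4 * (b ^ 4 - a ^ 4)).divisors.card : ℕ) : ℝ) ≤
      ((g ^ 4).divisors.card : ℝ) * ((b ^ 4 - a ^ 4).divisors.card : ℝ) := by
    exact_mod_cast card_divisors_mul_le _ _
  have h3 : ((b * g : ℕ) : ℝ) ^ (5 / 3 : ℝ) *
      (((b * g : ℕ) : ℝ) - ((a * g : ℕ) : ℝ)) ^ (1 / 3 : ℝ) =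
      (g : ℝ) ^ 2 * ((b : ℝ) ^ (5 / 3 : ℝ) * ((b : ℝ) - a) ^ (1 / 3 : ℝ)) := by
    have h4 : (g : ℝ) ^ 2 = (g : ℝ) ^ (5 / 3 : ℝ) * (g : ℝ) ^ (1 / 3 : ℝ) := by
      rw [← Real.rpow_add hg0, ← Real.rpow_natCast]; norm_num
    push_cast
    rw [← sub_mul, Real.mul_rpow hb0.le hg0.le, Real.mul_rpow hba.le hg0.le, h4]
    ring
  rw [h1, h3, coprimeTerm, coprimeTau, if_pos ⟨hab, hc⟩, Real.rpow_neg hba.le, Real.rpow_neg hb0.le]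
  calc _ ≤ ((g ^ 4).divisors.card : ℝ) * ((b ^ 4 - a ^ 4).divisors.card : ℝ) /
        ((g : ℝ) ^ 2 * ((b : ℝ) ^ (5 / 3 : ℝ) * ((b : ℝ) - a) ^ (1 / 3 : ℝ))) := by gcongr
    _ = _ := by field_simp

end QuarticDivisorSum

open QuarticDivisorSum in
theorem divisor_sum_quartic_unbalanced :
    ∃ C : ℝ, 0 < C ∧ ∀ x : ℝ, 2 ≤ x → ∀ y : ℝ, 0 < y →
      ∑ q ∈ (Finset.Icc 1 ⌊x⌋₊ ×ˢ Finset.Icc 1 ⌊x⌋₊).filter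
          (fun q : ℕ × ℕ => q.1 < q.2 ∧ (q.2 : ℝ) ≤ x ∧
            y * min (q.1 : ℝ) ((q.2 : ℝ) - (q.1 : ℝ)) < (q.2 : ℝ)),
        (tauFn (q.2 ^ 4 - q.1 ^ 4) : ℝ) /
          ((q.2 : ℝ) ^ ((5 : ℝ) / 3) * ((q.2 : ℝ) - (q.1 : ℝ)) ^ ((1 : ℝ) / 3)) ≤
      C * (Real.log x ^ 4 * y ^ (-(2 : ℝ) / 3) + 1) := by
  obtain ⟨C, hC0, hC⟩ := exists_sum_coprimeTerm_le
  obtain ⟨E, hE0, hE⟩ := exists_sum_card_divisors_pow_four_le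
  refine ⟨E * C, by positivity, fun x hx y hy ↦ ?_⟩
  set S := (Finset.Icc 1 ⌊x⌋₊ ×ˢ Finset.Icc 1 ⌊x⌋₊).filter
    (fun q : ℕ × ℕ => q.1 < q.2 ∧ (q.2 : ℝ) ≤ x ∧
      y * min (q.1 : ℝ) ((q.2 : ℝ) - (q.1 : ℝ)) < (q.2 : ℝ)) with hS
  set P := (Finset.Icc 1 ⌊x⌋₊ ×ˢ Finset.Icc 1 ⌊x⌋₊).filter
    (fun q : ℕ × ℕ ↦ y * min (q.1 : ℝ) ((q.2 : ℝ) - q.1) < q.2) with hP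
  let φ : ℕ × ℕ → ℕ × ℕ × ℕ := fun q ↦ (q.1.gcd q.2, q.1 / q.1.gcd q.2, q.2 / q.1.gcd q.2)
  let G : ℕ × ℕ × ℕ → ℝ := fun r ↦
    ((r.1 ^ 4).divisors.card : ℝ) / (r.1 : ℝ) ^ 2 * coprimeTerm r.2.1 r.2.2
  have hG (r : ℕ × ℕ × ℕ) : 0 ≤ G r := mul_nonneg (by positivity) (coprimeTerm_nonneg _ _)
  have hdecomp : ∀ q ∈ S, ∃ g a b : ℕ, 0 < g ∧ a.Coprime b ∧ q = (a * g, b * g) ∧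
      φ q = (g, a, b) := by
    rintro ⟨a, b⟩ hq
    have hab : a < b := (Finset.mem_filter.1 hq).2.1
    have hg : 0 < a.gcd b := Nat.gcd_pos_of_pos_right a (by omega)
    refine ⟨a.gcd b, a / a.gcd b, b / a.gcd b, hg, Nat.coprime_div_gcd_div_gcd hg, ?_, rfl⟩
    rw [Nat.div_mul_cancel (Nat.gcd_dvd_left a b), Nat.div_mul_cancel (Nat.gcd_dvd_right a b)]
  have hinj : Set.InjOn φ S := by
    intro q hq q' hq' h
    obtain ⟨g, a, b, -, -, h1, h2⟩ := hdecomp q hq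
    obtain ⟨g', a', b', -, -, h1', h2'⟩ := hdecomp q' hq'
    rw [h2, h2'] at h
    simp only [Prod.mk.injEq] at h
    obtain ⟨rfl, rfl, rfl⟩ := h
    rw [h1, h1']
  calc _ ≤ ∑ q ∈ S, G (φ q) := by
        refine Finset.sum_le_sum fun q hq ↦ ?_
        obtain ⟨g, a, b, hg, hc, rfl, hφ⟩ := hdecomp q hq
        have hab : a < b := Nat.lt_of_mul_lt_mul_right (Finset.mem_filter.1 hq).2.1
        rw [hφ]
        exact div_le_mul_coprimeTerm hg hab hc
    _ = ∑ r ∈ S.image φ, G r := (Finset.sum_image hinj).symm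
    _ ≤ ∑ r ∈ Finset.Icc 1 ⌊x⌋₊ ×ˢ P, G r := by
        refine Finset.sum_le_sum_of_subset_of_nonneg (fun r hr ↦ ?_) fun r _ _ ↦ hG r
        obtain ⟨q, hq, rfl⟩ := Finset.mem_image.1 hr
        obtain ⟨g, a, b, hg, hc, rfl, hφ⟩ := hdecomp q hq
        obtain ⟨h1, h2, h3, h4⟩ := Finset.mem_filter.1 hq
        rw [hφ]
        simp only [Finset.mem_product, Finset.mem_Icc, hP, Finset.mem_filter] at h1 h2 h4 ⊢
        have ha : 0 < a := Nat.pos_of_mul_pos_right h1.1.1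
        have hb : 0 < b := Nat.pos_of_mul_pos_right h1.2.1
        have hag : a ≤ a * g := Nat.le_mul_of_pos_right a hg
        have hbg : b ≤ b * g := Nat.le_mul_of_pos_right b hg
        have hgb : g ≤ b * g := Nat.le_mul_of_pos_left g hb
        refine ⟨⟨hg, by omega⟩, ⟨⟨ha, by omega⟩, hb, by omega⟩, ?_⟩
        have hg0 : (0 : ℝ) < g := by exact_mod_cast hg
        push_cast at h4
        rw [← sub_mul, ← min_mul_of_nonneg _ _ hg0.le, ← mul_assoc] at h4
        exact lt_of_mul_lt_mul_right h4 hg0.le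
    _ = (∑ g ∈ Finset.Icc 1 ⌊x⌋₊, ((g ^ 4).divisors.card : ℝ) / (g : ℝ) ^ 2) *
        ∑ q ∈ P, coprimeTerm q.1 q.2 := by
        rw [Finset.sum_mul_sum, Finset.sum_product]
    _ ≤ E * (C * (Real.log x ^ 4 * y ^ (-(2 : ℝ) / 3) + 1)) :=
        mul_le_mul (hE _) (hC x hx y hy)
          (Finset.sum_nonneg fun q _ ↦ coprimeTerm_nonneg _ _) hE0.le
    _ = _ := by ring
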